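/- Let V be a finite-dimensional real inner product space, κ ∈ ℝ, and let R : ℝ → End(V) be a smooth family of self-adjoint endomorphisms satisfying the radial intermediate Ricci bound Ric_k ≥ k·κ. Let Λ be a Lagrangian subspace of abstract Jacobi fields for R, let t₀ < t_max, and let λ̃ : [t₀, t_max) → ℝ be a solution of the scalar Riccati equation with parameter κ such that λ̃(t) → −∞ as t → t_max from the left. Let W ⊆ V be a k-dimensional subspace contained in {J(t₀) : J ∈ Λ} such that for some orthonormal basis (e₁, …, e_k) of W and some J₁, …, J_k ∈ Λ with Jᵢ(t₀) = eᵢ one has Σᵢ ⟨Jᵢ'(t₀), eᵢ⟩ ≤ k·λ̃(t₀). Let 𝒱 := {J ∈ Λ : J(t₀) ⊥ W} and assume 𝒱 has full index on [t₀, t_max). Then there is a subspace ℋ ⊆ Λ with Λ = 𝒱 ⊕ ℋ such that ⟨J(t), K(t)⟩ = 0 for all t ∈ [t₀, t_max), J ∈ 𝒱, K ∈ ℋ, and such that every nonzero K ∈ ℋ satisfies K(t) = f(t)·E on [t₀, t_max), where E is a unit vector of V lying in W and f : [t₀, t_max) → ℝ solves f'' + κ·f = 0 with f(t₀) = |K(t₀)|.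 -/

import Mathlib

open RealInnerProductSpace

variable {V : Type*} [NormedAddCommGroup V] [InnerProductSpace ℝ V]

/-- `J : ℝ → V` is an abstract Jacobi field for the curvature family `R`. -/
def IsJacobiField (R : ℝ → V →L[ℝ] V) (J : ℝ → V) : Prop :=
  ContDiff ℝ (⊤ : ℕ∞) J ∧ ∀ t : ℝ, deriv (deriv J) t = -(R t (J t))

/-- A Lagrangian subspace of abstract Jacobi fields: a subspace of the space of
Jacobi fields for `R` of dimension `dim V` on which the Wronskian vanishes. -/
def IsLagrangian [FiniteDimensional ℝ V] (R : ℝ → V →L[ℝ] V)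
    (Λ : Submodule ℝ (ℝ → V)) : Prop :=
  (∀ J ∈ Λ, IsJacobiField R J) ∧
    Module.finrank ℝ Λ = Module.finrank ℝ V ∧
    ∀ J₁ ∈ Λ, ∀ J₂ ∈ Λ, ∀ t : ℝ, ⟪deriv J₁ t, J₂ t⟫ = ⟪J₁ t, deriv J₂ t⟫

/-- `𝒲(t) = {J(t) : J ∈ 𝒲} + {J'(t) : J ∈ 𝒲, J(t) = 0}`. -/
def evalSp (𝒲 : Submodule ℝ (ℝ → V)) (t : ℝ) : Submodule ℝ V :=
  Submodule.span ℝ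
    ({x : V | ∃ J ∈ 𝒲, J t = x} ∪ {x : V | ∃ J ∈ 𝒲, J t = 0 ∧ deriv J t = x})

/-- Differentiation under the integral sign for the averages `∫₀¹ uⁿ F(τ + u (t - τ)) du`. -/
theorem hasDerivAt_integral_pow_smul_comp_lineMap {E : Type*} [NormedAddCommGroup E]
    [NormedSpace ℝ E] (n : ℕ) {F F' : ℝ → E} (τ t : ℝ)
    (hF : ∀ x, HasDerivAt F (F' x) x) (hF' : Continuous F') :
    HasDerivAt (fun t => ∫ u in (0 : ℝ)..1, u ^ n • F (τ + u * (t - τ)))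
      (∫ u in (0 : ℝ)..1, u ^ (n + 1) • F' (τ + u * (t - τ))) t := by
  have hFc : Continuous F := continuous_iff_continuousAt.2 fun x => (hF x).continuousAt
  obtain ⟨C, hC⟩ := (isCompact_closedBall τ (|t - τ| + 1)).exists_bound_of_continuousOn
    hF'.continuousOn
  refine (intervalIntegral.hasDerivAt_integral_of_dominated_loc_of_deriv_le
    (F := fun t u => u ^ n • F (τ + u * (t - τ)))
    (F' := fun t u => u ^ (n + 1) • F' (τ + u * (t - τ)))
    (bound := fun _ => C) (Metric.ball_mem_nhds t one_pos) ?_ ?_ ?_ ?_ ?_ ?_).2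
  · exact .of_forall fun x => (by fun_prop : Continuous _).aestronglyMeasurable
  · exact (by fun_prop : Continuous _).intervalIntegrable _ _
  · exact (by fun_prop : Continuous _).aestronglyMeasurable
  · refine .of_forall fun u hu x hx => ?_
    rw [Set.uIoc_of_le zero_le_one] at hu
    have hu1 : |u| ≤ 1 := abs_le.2 ⟨by linarith [hu.1], hu.2⟩
    have hmem : τ + u * (x - τ) ∈ Metric.closedBall τ (|t - τ| + 1) := by
      rw [mem_closedBall_iff_norm, add_sub_cancel_left, Real.norm_eq_abs, abs_mul]
      rw [mem_ball_iff_norm, Real.norm_eq_abs] at hx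
      have : |x - τ| ≤ |x - t| + |t - τ| := abs_sub_le _ _ _
      nlinarith [abs_nonneg (x - τ), abs_nonneg u]
    rw [norm_smul, norm_pow, Real.norm_eq_abs]
    exact (mul_le_of_le_one_left (norm_nonneg _) (pow_le_one₀ (abs_nonneg _) hu1)).trans
      (hC _ hmem)
  · exact intervalIntegrable_const
  · refine .of_forall fun u _ x _ => ?_
    have h1 : HasDerivAt (fun x : ℝ => τ + u * (x - τ)) u x := by
      simpa using (((hasDerivAt_id x).sub_const τ).const_mul u).const_add τ
    have := ((hF (τ + u * (x - τ))).scomp x h1).const_smul (u ^ n)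
    simpa [Function.comp_def, Pi.smul_def, smul_smul, pow_succ] using this

/-- Hadamard's lemma on the line: the difference quotient of a smooth function at `τ` is twice
differentiable across `τ`. -/
theorem exists_smooth_slope {E : Type*} [NormedAddCommGroup E] [NormedSpace ℝ E]
    [CompleteSpace E] {F : ℝ → E} (hF : ContDiff ℝ (⊤ : ℕ∞) F) (τ : ℝ) :
    ∃ G G' : ℝ → E, ∃ G'' : E, (∀ t, (t - τ) • G t = F t - F τ) ∧ G τ = deriv F τ ∧
      (∀ t, HasDerivAt G (G' t) t) ∧ G' τ = (2 : ℝ)⁻¹ • deriv (deriv F) τ ∧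
      HasDerivAt G' G'' τ := by
  have hd : ∀ {f : ℝ → E}, ContDiff ℝ (⊤ : ℕ∞) f →
      ContDiff ℝ (⊤ : ℕ∞) (deriv f) ∧ ∀ x, HasDerivAt f (deriv f x) x := fun {f} hf =>
    ⟨(contDiff_infty_iff_deriv.1 hf).2, fun x => (hf.differentiable (by simp) x).hasDerivAt⟩
  obtain ⟨h1, d0⟩ := hd hF
  obtain ⟨h2, d1⟩ := hd h1
  obtain ⟨h3, d2⟩ := hd h2
  refine ⟨fun t => ∫ u in (0 : ℝ)..1, u ^ 0 • deriv F (τ + u * (t - τ)),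
    fun t => ∫ u in (0 : ℝ)..1, u ^ 1 • deriv (deriv F) (τ + u * (t - τ)), _, fun t => ?_, ?_,
    fun t => hasDerivAt_integral_pow_smul_comp_lineMap 0 τ t d1 h2.continuous, ?_,
    hasDerivAt_integral_pow_smul_comp_lineMap 1 τ τ d2 h3.continuous⟩
  · have := intervalIntegral.smul_integral_comp_add_mul (a := 0) (b := 1) (deriv F) (t - τ) τ
    simp only [pow_zero, one_smul]
    simp_rw [mul_comm _ (t - τ)]
    rw [this, intervalIntegral.integral_eq_sub_of_hasDerivAt (fun x _ => d0 x)
      (h1.continuous.intervalIntegrable _ _)]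
    simp
  · simp
  · simp only [sub_self, mul_zero, add_zero]
    rw [intervalIntegral.integral_smul_const]
    norm_num

/-- The trace as a continuous linear functional on continuous endomorphisms. -/
noncomputable def clmTrace [FiniteDimensional ℝ V] : (V →L[ℝ] V) →L[ℝ] ℝ :=
  LinearMap.toContinuousLinearMap
    (LinearMap.trace ℝ V ∘ₗ ContinuousLinearMap.coeLM ℝ)

section Trace

variable [FiniteDimensional ℝ V]

theorem clmTrace_apply (A : V →L[ℝ] V) : clmTrace A = LinearMap.trace ℝ V (A : V →ₗ[ℝ] V) := rfl

theorem clmTrace_mul_comm (A B : V →L[ℝ] V) : clmTrace (A * B) = clmTrace (B * A) :=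
  LinearMap.trace_mul_comm ℝ (A : V →ₗ[ℝ] V) (B : V →ₗ[ℝ] V)

theorem clmTrace_star_mul_self [CompleteSpace V] (A : V →L[ℝ] V) :
    clmTrace (star A * A) = ∑ i, ‖A (stdOrthonormalBasis ℝ V i)‖ ^ 2 := by
  rw [clmTrace_apply, LinearMap.trace_eq_sum_inner _ (stdOrthonormalBasis ℝ V)]
  refine Finset.sum_congr rfl fun i _ => ?_
  change ⟪_, (star A * A) _⟫ = _
  rw [ContinuousLinearMap.star_eq_adjoint, mul_apply_eq_comp,
    ContinuousLinearMap.adjoint_inner_right, real_inner_self_eq_norm_sq]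

theorem clmTrace_star_mul_self_nonneg [CompleteSpace V] (A : V →L[ℝ] V) :
    0 ≤ clmTrace (star A * A) := by
  rw [clmTrace_star_mul_self]
  positivity

theorem eq_zero_of_clmTrace_star_mul_self_nonpos [CompleteSpace V] {A : V →L[ℝ] V}
    (h : clmTrace (star A * A) ≤ 0) : A = 0 := by
  rw [clmTrace_star_mul_self] at h
  have h0 := (Finset.sum_eq_zero_iff_of_nonneg fun i _ => by positivity).1
    (le_antisymm h (by positivity))
  refine ContinuousLinearMap.coe_injective
    ((stdOrthonormalBasis ℝ V).toBasis.ext fun i => ?_)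
  simpa using h0 i (Finset.mem_univ i)

theorem clmTrace_starProjection_mul {k : ℕ} {H : Submodule ℝ V} {e : Fin k → V}
    (he : Orthonormal ℝ e) (hH : Submodule.span ℝ (Set.range e) = H) (A : V →L[ℝ] V) :
    clmTrace (H.starProjection * A) = ∑ i, ⟪A (e i), e i⟫ := by
  subst hH
  have hP : ∀ x, (Submodule.span ℝ (Set.range e)).starProjection x = ∑ i, ⟪e i, x⟫ • e i := by
    intro x
    refine Submodule.eq_starProjection_of_mem_of_inner_eq_zero
      (Submodule.sum_mem _ fun i _ => Submodule.smul_mem _ _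
        (Submodule.subset_span (R := ℝ) (s := Set.range e) (Set.mem_range_self i))) ?_
    intro w hw
    induction hw using Submodule.span_induction with
    | mem y hy =>
      obtain ⟨j, rfl⟩ := hy
      rw [inner_sub_left, real_inner_comm, sum_inner]
      simp [inner_smul_left, orthonormal_iff_ite.1 he]
    | zero => simp
    | add y z _ _ hy hz => rw [inner_add_right, hy, hz, add_zero]
    | smul c y _ hy => rw [inner_smul_right, hy, mul_zero]
  rw [clmTrace_mul_comm, clmTrace_apply]
  have : ((A * (Submodule.span ℝ (Set.range e)).starProjection : V →L[ℝ] V) : V →ₗ[ℝ] V) =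
      ∑ i, ((innerSL ℝ (e i) : V →L[ℝ] ℝ) : V →ₗ[ℝ] ℝ).smulRight (A (e i)) := by
    ext x
    simp [hP]
  rw [this, map_sum]
  refine Finset.sum_congr rfl fun i _ => ?_
  rw [LinearMap.trace_smulRight]
  simp [real_inner_comm]

end Trace

section Projection

variable [CompleteSpace V]

open Filter Topology

/-- Derivative of the inverse along a curve through the identity. -/
theorem HasDerivAt.ringInverse_of_eq_one {B : ℝ → V →L[ℝ] V} {b : V →L[ℝ] V} {τ : ℝ}
    (hB : HasDerivAt B b τ) (h1 : B τ = 1) :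
    HasDerivAt (fun t => Ring.inverse (B t)) (-b) τ := by
  have h := hasFDerivAt_ringInverse (𝕜 := ℝ) (1 : (V →L[ℝ] V)ˣ)
  rw [Units.val_one, ← h1] at h
  simpa using! h.comp_hasDerivAt τ hB

theorem eventually_isUnit_of_eq_one {B : ℝ → V →L[ℝ] V} {b : V →L[ℝ] V} {τ : ℝ}
    (hB : HasDerivAt B b τ) (h1 : B τ = 1) : ∀ᶠ t in 𝓝 τ, IsUnit (B t) := by
  have : {x : V →L[ℝ] V | IsUnit x} ∈ 𝓝 (B τ) := by
    rw [h1]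
    exact Units.isOpen.mem_nhds isUnit_one
  exact hB.continuousAt this

/-- If the projections `Q t` annihilate `B t * p` and fix the range of
`star (B t)⁻¹ * (1 - p)`, where `B τ = 1`, then `Q` is differentiable at `τ`, with derivative
determined by the off-diagonal part of the derivative of `B`. -/
theorem hasDerivAt_projection {B Q : ℝ → V →L[ℝ] V} {b p : V →L[ℝ] V} {τ : ℝ}
    (hB : HasDerivAt B b τ) (h1 : B τ = 1)
    (hQB : ∀ᶠ t in 𝓝 τ, Q t * (B t * p) = 0)
    (hQC : ∀ᶠ t in 𝓝 τ, Q t * (star (Ring.inverse (B t)) * (1 - p)) =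
      star (Ring.inverse (B t)) * (1 - p)) :
    HasDerivAt Q (-((1 - p) * b * p) - p * star b * (1 - p)) τ := by
  have hC := (hB.ringInverse_of_eq_one h1).star
  have hE : HasDerivAt (fun t => B t * p + star (Ring.inverse (B t)) * (1 - p))
      (b * p + star (-b) * (1 - p)) τ := (hB.mul_const p).add (hC.mul_const (1 - p))
  have hE1 : B τ * p + star (Ring.inverse (B τ)) * (1 - p) = 1 := by simp [h1]
  have hEi := hE.ringInverse_of_eq_one hE1
  have key := (hC.mul_const (1 - p)).mul hEi
  have hev : Q =ᶠ[𝓝 τ] fun t => star (Ring.inverse (B t)) * (1 - p) *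
      Ring.inverse (B t * p + star (Ring.inverse (B t)) * (1 - p)) := by
    filter_upwards [hQB, hQC, eventually_isUnit_of_eq_one hE hE1] with t ht1 ht2 ht3
    have h : Q t * (B t * p + star (Ring.inverse (B t)) * (1 - p)) =
        star (Ring.inverse (B t)) * (1 - p) := by rw [mul_add, ht1, ht2, zero_add]
    calc Q t = Q t * ((B t * p + star (Ring.inverse (B t)) * (1 - p)) *
          Ring.inverse (B t * p + star (Ring.inverse (B t)) * (1 - p))) := by
          rw [Ring.mul_inverse_cancel _ ht3, mul_one]
      _ = _ := by rw [← mul_assoc, h]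
  refine (key.congr_of_eventuallyEq hev).congr_deriv ?_
  rw [hE1, h1, Ring.inverse_one, star_one, star_neg]
  noncomm_ring

/-- The transverse Riccati equation in trace form, relative to a frame `B` with `B τ = 1`. -/
theorem hasDerivAt_trace_riccati [FiniteDimensional ℝ V] {B B' Q : ℝ → V →L[ℝ] V} {s : ℝ → ℝ}
    {b'' p r : V →L[ℝ] V} {τ : ℝ}
    (hB : ∀ t, HasDerivAt B (B' t) t) (hB' : HasDerivAt B' b'' τ) (h1 : B τ = 1)
    (hp : p * p = p) (hQτ : Q τ = 1 - p)
    (hQB : ∀ᶠ t in 𝓝 τ, Q t * (B t * p) = 0)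
    (hQC : ∀ᶠ t in 𝓝 τ, Q t * (star (Ring.inverse (B t)) * (1 - p)) =
      star (Ring.inverse (B t)) * (1 - p))
    (hs : ∀ᶠ t in 𝓝 τ, s t = clmTrace (Q t * (B' t * Ring.inverse (B t))))
    (hS : star ((1 - p) * B' τ * (1 - p)) = (1 - p) * B' τ * (1 - p))
    (hA : star ((1 - p) * B' τ * p) = p * B' τ * (1 - p)) (hpsa : star p = p)
    (hr : (1 - p) * b'' * (1 - p) = -((1 - p) * r * (1 - p))) :
    HasDerivAt s (-clmTrace ((1 - p) * r)
      - clmTrace (star ((1 - p) * B' τ * (1 - p)) * ((1 - p) * B' τ * (1 - p)))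
      - 3 * clmTrace (star ((1 - p) * B' τ * p) * ((1 - p) * B' τ * p))) τ := by
  set b := B' τ with hb
  set q := 1 - p with hq
  have hqq : q * q = q := by simp [hq, sub_mul, mul_sub, hp]
  have hpq : p + q = 1 := by simp [hq]
  have hqsa : star q = q := by simp [hq, hpsa]
  have hQ := hasDerivAt_projection (hB τ) h1 hQB hQC
  have key := hQ.mul (hB'.mul ((hB τ).ringInverse_of_eq_one h1))
  have key2 := (clmTrace (V := V)).hasFDerivAt.comp_hasDerivAt τ key
  refine (key2.congr_of_eventuallyEq hs).congr_deriv ?_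
  simp only [Pi.mul_apply, ← hb, ← hq, hQτ, h1, Ring.inverse_one, mul_one]
  have hcyc : ∀ X : V →L[ℝ] V, clmTrace (q * X) = clmTrace (q * X * q) := fun X => by
    rw [clmTrace_mul_comm (q * X) q, ← mul_assoc, hqq]
  have hpcyc : ∀ X : V →L[ℝ] V, clmTrace (p * X) = clmTrace (p * X * p) := fun X => by
    rw [clmTrace_mul_comm (p * X) p, ← mul_assoc, hp]
  have e1 : clmTrace (q * r) = -clmTrace (q * b'') := by
    rw [hcyc r, hcyc b'', hr, map_neg, neg_neg]
  have hAs : p * star b * q = star (q * b * p) := by simp [hpsa, hqsa, mul_assoc]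
  have e2 : clmTrace (q * b * p * b) = clmTrace (star (q * b * p) * (q * b * p)) := by
    have : q * b * p * b = q * (b * p * b) := by simp only [mul_assoc]
    rw [this, hcyc, clmTrace_mul_comm (star _), hA]
    congr 1
    simp only [mul_assoc]
    rw [← mul_assoc p p, hp]
  have e3 : clmTrace (p * star b * q * b) = clmTrace (star (q * b * p) * (q * b * p)) := by
    rw [← hAs, mul_assoc, mul_assoc, hpcyc]
    congr 1
    simp only [mul_assoc]
    rw [← mul_assoc q q, hqq]
  have e4 : clmTrace (q * (b * b)) = clmTrace (star (q * b * q) * (q * b * q)) +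
      clmTrace (star (q * b * p) * (q * b * p)) := by
    have h2 : q * (b * b) * q = q * b * q * (q * b * q) + q * b * p * (p * b * q) := by
      have : q * b * q * (q * b * q) + q * b * p * (p * b * q) =
          q * b * (q * q) * b * q + q * b * (p * p) * b * q := by simp only [mul_assoc]
      rw [this, hqq, hp, ← add_mul, ← add_mul, ← mul_add, add_comm q p, hpq]
      simp only [mul_assoc, one_mul]
    rw [hcyc, h2, map_add, hS, hA, clmTrace_mul_comm (p * b * q)]
  simp only [sub_mul, mul_add, neg_mul, mul_neg, map_add, map_sub, map_neg, e1, e2, e3, e4]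
  ring

end Projection

/-- `N` encodes a Lagrangian family of Jacobi fields `t ↦ N t x`, parametrised linearly by
`x : V`. -/
structure IsJacobiTensor (R N : ℝ → V →L[ℝ] V) : Prop where
  contDiff : ContDiff ℝ (⊤ : ℕ∞) N
  deriv_deriv : ∀ t, deriv (deriv N) t = -(R t * N t)
  wronskian : ∀ t x y, ⟪deriv N t x, N t y⟫ = ⟪N t x, deriv N t y⟫
  eq_zero : ∀ t x, N t x = 0 → deriv N t x = 0 → x = 0

/-- The derivatives at `t` of the fields that vanish at `t`. -/
noncomputable def conjSpace (N : ℝ → V →L[ℝ] V) (t : ℝ) : Submodule ℝ V :=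
  (LinearMap.ker (N t : V →ₗ[ℝ] V)).map ((deriv N t : V →L[ℝ] V) : V →ₗ[ℝ] V)

theorem deriv_mem_conjSpace {N : ℝ → V →L[ℝ] V} {t : ℝ} {x : V} (h : N t x = 0) :
    deriv N t x ∈ conjSpace N t :=
  ⟨x, h, rfl⟩

theorem mem_conjSpace {N : ℝ → V →L[ℝ] V} {t : ℝ} {z : V} :
    z ∈ conjSpace N t ↔ ∃ x, N t x = 0 ∧ deriv N t x = z :=
  Iff.rfl

section Transverse

set_option linter.unusedSectionVars false

variable [FiniteDimensional ℝ V] [CompleteSpace V]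

open Filter Topology

/-- The regularised evaluation at `t`: it agrees with `N t` up to the derivatives of the fields
that vanish at `t`, and it is invertible even at conjugate times. -/
noncomputable def jacobiFrame (N : ℝ → V →L[ℝ] V) (t : ℝ) : V →L[ℝ] V :=
  N t + (conjSpace N t).starProjection * deriv N t

/-- The orthogonal complement of the evaluation at `t` of the fields parametrised by `U`. -/
noncomputable def transverseSp (N : ℝ → V →L[ℝ] V) (U : Submodule ℝ V) (t : ℝ) :
    Submodule ℝ V :=
  (U.map (jacobiFrame N t : V →ₗ[ℝ] V))ᗮ

/-- The shape operator sending the regularised value of a field at `t` to its derivative. -/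
noncomputable def jacobiShape (N : ℝ → V →L[ℝ] V) (t : ℝ) : V →L[ℝ] V :=
  deriv N t * Ring.inverse (jacobiFrame N t)

/-- The trace of the transverse Riccati operator. -/
noncomputable def transverseTrace (N : ℝ → V →L[ℝ] V) (U : Submodule ℝ V) (t : ℝ) : ℝ :=
  clmTrace ((transverseSp N U t).starProjection * jacobiShape N t)

variable {R N : ℝ → V →L[ℝ] V} {U : Submodule ℝ V}

theorem isUnit_of_injective {A : V →L[ℝ] V} (h : ∀ x, A x = 0 → x = 0) : IsUnit A := by
  have hi : Function.Injective (A : V →ₗ[ℝ] V) := (injective_iff_map_eq_zero _).2 h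
  exact ContinuousLinearMap.isUnit_iff_bijective.2
    ⟨hi, LinearMap.injective_iff_surjective.1 hi⟩

theorem eq_zero_of_isUnit {A : V →L[ℝ] V} (h : IsUnit A) {x : V} (hx : A x = 0) : x = 0 :=
  (ContinuousLinearMap.isUnit_iff_bijective.1 h).1 (hx.trans (map_zero A).symm)

theorem jacobiFrame_apply (t : ℝ) (x : V) :
    jacobiFrame N t x = N t x + (conjSpace N t).starProjection (deriv N t x) := rfl

theorem jacobiFrame_apply_of_eq_zero {t : ℝ} {x : V} (h : N t x = 0) :
    jacobiFrame N t x = deriv N t x := by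
  rw [jacobiFrame_apply, h, zero_add,
    Submodule.starProjection_eq_self_iff.2 (deriv_mem_conjSpace h)]

theorem starProjection_mul_eq_self {K L : Submodule ℝ V} (h : K ≤ L) :
    L.starProjection * K.starProjection = K.starProjection := by
  ext x
  exact Submodule.starProjection_eq_self_iff.2 (h (K.starProjection_apply_mem x))

theorem star_starProjection (K : Submodule ℝ V) : star K.starProjection = K.starProjection := by
  rw [ContinuousLinearMap.star_eq_adjoint]
  exact (ContinuousLinearMap.isSelfAdjoint_iff_isSymmetric.2 K.starProjection_isSymmetric)

namespace IsJacobiTensor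

theorem hasDerivAt (hN : IsJacobiTensor R N) (t : ℝ) : HasDerivAt N (deriv N t) t :=
  (hN.contDiff.differentiable (by simp) t).hasDerivAt

theorem hasDerivAt_deriv (hN : IsJacobiTensor R N) (t : ℝ) :
    HasDerivAt (deriv N) (-(R t * N t)) t := by
  rw [← hN.deriv_deriv t]
  exact ((contDiff_infty_iff_deriv.1 hN.contDiff).2.differentiable (by simp) t).hasDerivAt

theorem inner_eq_zero (hN : IsJacobiTensor R N) {t : ℝ} {z : V} (hz : z ∈ conjSpace N t)
    (x : V) : ⟪z, N t x⟫ = 0 := by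
  obtain ⟨y, hy, rfl⟩ := mem_conjSpace.1 hz
  rw [hN.wronskian, hy, inner_zero_left]

theorem starProjection_mul (hN : IsJacobiTensor R N) (t : ℝ) :
    (conjSpace N t).starProjection * N t = 0 := by
  ext x
  exact (Submodule.starProjection_apply_eq_zero_iff _).2 fun z hz => hN.inner_eq_zero hz x

theorem isUnit_jacobiFrame (hN : IsJacobiTensor R N) (t : ℝ) : IsUnit (jacobiFrame N t) := by
  refine isUnit_of_injective fun x hx => ?_
  have h0 : N t x = 0 := by
    have h1 : ⟪N t x, jacobiFrame N t x⟫ = 0 := by rw [hx, inner_zero_right]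
    rw [jacobiFrame_apply, inner_add_right, real_inner_comm ((conjSpace N t).starProjection _) (N t x),
      hN.inner_eq_zero (Submodule.starProjection_apply_mem _ _), add_zero] at h1
    exact inner_self_eq_zero.1 h1
  exact hN.eq_zero t x h0 ((jacobiFrame_apply_of_eq_zero h0).symm.trans hx)

theorem jacobiShape_mul_jacobiFrame (hN : IsJacobiTensor R N) (t : ℝ) :
    jacobiShape N t * jacobiFrame N t = deriv N t := by
  rw [jacobiShape, mul_assoc, Ring.inverse_mul_cancel _ (hN.isUnit_jacobiFrame t), mul_one]

theorem starProjection_mul_jacobiShape (hN : IsJacobiTensor R N) (t : ℝ) :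
    (conjSpace N t).starProjection * jacobiShape N t = (conjSpace N t).starProjection := by
  refine (hN.isUnit_jacobiFrame t).mul_left_injective ?_
  simp only
  rw [mul_assoc, hN.jacobiShape_mul_jacobiFrame, jacobiFrame, mul_add, hN.starProjection_mul,
    zero_add, ← mul_assoc, starProjection_mul_eq_self le_rfl]

theorem jacobiShape_mul_starProjection (hN : IsJacobiTensor R N) (t : ℝ) :
    jacobiShape N t * (conjSpace N t).starProjection = (conjSpace N t).starProjection := by
  ext x
  obtain ⟨y, hy, hyx⟩ := mem_conjSpace.1 (Submodule.starProjection_apply_mem (conjSpace N t) x)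
  change jacobiShape N t ((conjSpace N t).starProjection x) = (conjSpace N t).starProjection x
  rw [← hyx]
  nth_rewrite 1 [← jacobiFrame_apply_of_eq_zero hy]
  exact DFunLike.congr_fun (hN.jacobiShape_mul_jacobiFrame t) y

theorem mul_inverse_jacobiFrame (hN : IsJacobiTensor R N) (t : ℝ) :
    N t * Ring.inverse (jacobiFrame N t) = 1 - (conjSpace N t).starProjection := by
  refine (hN.isUnit_jacobiFrame t).mul_left_injective ?_
  simp only
  rw [mul_assoc, Ring.inverse_mul_cancel _ (hN.isUnit_jacobiFrame t), mul_one, sub_mul, one_mul,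
    jacobiFrame, mul_add, hN.starProjection_mul, ← mul_assoc, starProjection_mul_eq_self le_rfl]
  abel

theorem star_jacobiShape_mul (hN : IsJacobiTensor R N) (t : ℝ) :
    star (jacobiShape N t) * (1 - (conjSpace N t).starProjection) =
      (1 - (conjSpace N t).starProjection) * jacobiShape N t := by
  have hw : star (deriv N t) * N t = star (N t) * deriv N t := by
    ext x
    refine ext_inner_left ℝ fun y => ?_
    simp only [ContinuousLinearMap.star_eq_adjoint, mul_apply_eq_comp,
      ContinuousLinearMap.adjoint_inner_right]
    exact hN.wronskian t y x
  have h1 : star (1 - (conjSpace N t).starProjection) = 1 - (conjSpace N t).starProjection := by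
    rw [star_sub, star_one, star_starProjection]
  nth_rewrite 2 [← h1]
  rw [← hN.mul_inverse_jacobiFrame, jacobiShape, star_mul, star_mul]
  simp only [mul_assoc]
  rw [← mul_assoc (star (deriv N t)), hw]
  simp only [mul_assoc]

theorem conjSpace_le {τ : ℝ} (hfull : ∀ x, N τ x = 0 → x ∈ U) :
    conjSpace N τ ≤ U.map (jacobiFrame N τ : V →ₗ[ℝ] V) := by
  intro z hz
  obtain ⟨x, hx, rfl⟩ := mem_conjSpace.1 hz
  exact ⟨x, hfull x hx, jacobiFrame_apply_of_eq_zero hx⟩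

theorem jacobiFrame_eq_of_isUnit {t : ℝ} (h : IsUnit (N t)) : jacobiFrame N t = N t := by
  have : conjSpace N t = ⊥ := by
    rw [eq_bot_iff]
    rintro z hz
    obtain ⟨x, hx, rfl⟩ := mem_conjSpace.1 hz
    rw [eq_zero_of_isUnit h hx, map_zero]
    exact Submodule.zero_mem _
  simp [jacobiFrame, this]

end IsJacobiTensor

end Transverse

section TransverseRiccati

set_option linter.unusedSectionVars false

variable [FiniteDimensional ℝ V] [CompleteSpace V] {R N : ℝ → V →L[ℝ] V} {U : Submodule ℝ V}
  {τ : ℝ}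

open Filter Topology

namespace IsJacobiTensor

theorem starProjection_conjSpace_mul (hfull : ∀ x, N τ x = 0 → x ∈ U) :
    (conjSpace N τ).starProjection * (transverseSp N U τ).starProjection = 0 := by
  have h := starProjection_mul_eq_self (conjSpace_le hfull)
  have h2 := congrArg star h
  rw [star_mul, star_starProjection, star_starProjection] at h2
  have h3 : (transverseSp N U τ).starProjection =
      1 - (U.map (jacobiFrame N τ : V →ₗ[ℝ] V)).starProjection :=
    Submodule.starProjection_orthogonal' _
  rw [h3, mul_sub, mul_one, h2, sub_self]

theorem mul_starProjection_conjSpace (hfull : ∀ x, N τ x = 0 → x ∈ U) :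
    (transverseSp N U τ).starProjection * (conjSpace N τ).starProjection = 0 := by
  have h := congrArg star (starProjection_conjSpace_mul hfull)
  rwa [star_mul, star_starProjection, star_starProjection, star_zero] at h

/-- Near `τ` there is a smooth frame `B` with `B τ = 1` such that the fields parametrised by
`jacobiFrame N τ` are `B t` applied to the diagonal factor
`(1 - Z) + (t - τ) Z`, with `Z` the projection to `conjSpace N τ`. -/
theorem exists_frame (hN : IsJacobiTensor R N) (τ : ℝ) :
    ∃ B B' : ℝ → V →L[ℝ] V, ∃ G : V →L[ℝ] V,
      (∀ t, N t = B t * ((1 - (conjSpace N τ).starProjection) +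
        (t - τ) • (conjSpace N τ).starProjection) * jacobiFrame N τ) ∧
      B τ = 1 ∧ (∀ t, HasDerivAt B (B' t) t) ∧
      B' τ = jacobiShape N τ * (1 - (conjSpace N τ).starProjection) ∧
      HasDerivAt B' (-(R τ * (1 - (conjSpace N τ).starProjection)) +
        G * (conjSpace N τ).starProjection) τ := by
  set Z := (conjSpace N τ).starProjection with hZ
  set Φ := jacobiFrame N τ with hΦ
  set Ψ := Ring.inverse Φ with hΨ
  have hu : IsUnit Φ := hN.isUnit_jacobiFrame τ
  have hZZ : Z * Z = Z := starProjection_mul_eq_self le_rfl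
  have hM : N τ * Ψ = 1 - Z := hN.mul_inverse_jacobiFrame τ
  have hT : deriv N τ * Ψ = jacobiShape N τ := rfl
  have hTZ : jacobiShape N τ * Z = Z := hN.jacobiShape_mul_starProjection τ
  have hZc : (1 - Z) * (1 - Z) = 1 - Z := by
    simp only [sub_mul, mul_sub, hZZ, one_mul, mul_one]; abel
  have hZ0 : (1 - Z) * Z = 0 := by rw [sub_mul, one_mul, hZZ, sub_self]
  have hZ0' : Z * (1 - Z) = 0 := by rw [mul_sub, mul_one, hZZ, sub_self]
  have hd1 : ∀ t (X : V →L[ℝ] V), HasDerivAt (fun t => N t * X) (deriv N t * X) t :=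
    fun t X => (hN.hasDerivAt t).mul_const X
  have hd2 : ∀ t (X : V →L[ℝ] V), HasDerivAt (fun t => deriv N t * X) (-(R t * N t) * X) t :=
    fun t X => (hN.hasDerivAt_deriv t).mul_const X
  have hF : ContDiff ℝ (⊤ : ℕ∞) fun t => N t * (Ψ * Z) := hN.contDiff.mul contDiff_const
  have hF1 : deriv (fun t => N t * (Ψ * Z)) = fun t => deriv N t * (Ψ * Z) :=
    funext fun t => (hd1 t _).deriv
  obtain ⟨G, G', G'', hG, hGτ, hGd, hG'τ, hG'd⟩ := exists_smooth_slope hF τ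
  rw [hF1] at hGτ hG'τ
  rw [(hd2 τ _).deriv, neg_mul, mul_assoc, ← mul_assoc (N τ), hM, hZ0, mul_zero, neg_zero,
    smul_zero] at hG'τ
  replace hGτ : G τ = Z := by
    rw [hGτ]
    change deriv N τ * (Ψ * Z) = Z
    rw [← mul_assoc, hT, hTZ]
  refine ⟨fun t => N t * (Ψ * (1 - Z)) + G t * Z,
    fun t => deriv N t * (Ψ * (1 - Z)) + G' t * Z, G'', fun t => ?_, ?_,
    fun t => (hd1 t _).add ((hGd t).mul_const Z), ?_, ?_⟩
  · have h1 := hG t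
    rw [← mul_assoc (N τ), hM, hZ0, sub_zero] at h1
    have h2 : (N t * (Ψ * (1 - Z)) + G t * Z) * (1 - Z + (t - τ) • Z) = N t * Ψ := by
      calc _ = N t * (Ψ * ((1 - Z) * (1 - Z))) + (t - τ) • (N t * (Ψ * ((1 - Z) * Z))) +
            G t * (Z * (1 - Z)) + ((t - τ) • G t) * (Z * Z) := by
              simp only [add_mul, mul_add, mul_smul_comm, smul_mul_assoc, smul_add, mul_assoc]; abel
        _ = _ := by
          rw [hZc, hZ0, hZ0', hZZ, h1, mul_assoc, mul_assoc, hZZ, mul_zero, mul_zero, smul_zero,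
            mul_zero, add_zero, add_zero, ← mul_add, ← mul_add, sub_add_cancel, mul_one]
    change N t = (N t * (Ψ * (1 - Z)) + G t * Z) * (1 - Z + (t - τ) • Z) * Φ
    rw [h2, mul_assoc, Ring.inverse_mul_cancel _ hu, mul_one]
  · simp only
    rw [hGτ, hZZ, ← mul_assoc, hM, hZc, sub_add_cancel]
  · simp only
    rw [hG'τ, zero_mul, add_zero, ← mul_assoc, hT]
  · refine ((hd2 τ _).add (hG'd.mul_const Z)).congr_deriv ?_
    rw [neg_mul, mul_assoc, ← mul_assoc (N τ), hM, hZc]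

/-- The transverse Riccati equation: derivatives of the transverse trace and of the transverse
projection at any time at which `U` contains all vanishing fields. -/
theorem hasDerivAt_transverse (hN : IsJacobiTensor R N) (hfull : ∀ x, N τ x = 0 → x ∈ U)
    {Q T : V →L[ℝ] V} (hQ : Q = (transverseSp N U τ).starProjection)
    (hT : T = jacobiShape N τ) :
    star (Q * T * Q) = Q * T * Q ∧
    HasDerivAt (transverseTrace N U) (-clmTrace (Q * R τ)
      - clmTrace (star (Q * T * Q) * (Q * T * Q))
      - 3 * clmTrace (star (Q * T * (1 - Q)) * (Q * T * (1 - Q)))) τ ∧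
    HasDerivAt (fun t => (transverseSp N U t).starProjection)
      (-(Q * T * (1 - Q)) - star (Q * T * (1 - Q))) τ := by
  obtain ⟨B, B', G, hNB, hB1, hB, hB'τ, hB'⟩ := hN.exists_frame τ
  have hZT := hN.starProjection_mul_jacobiShape τ
  have hTZ := hN.jacobiShape_mul_starProjection τ
  have hW := hN.star_jacobiShape_mul τ
  have hZQ : (conjSpace N τ).starProjection * Q = 0 := hQ ▸ starProjection_conjSpace_mul hfull
  have hQZ : Q * (conjSpace N τ).starProjection = 0 := hQ ▸ mul_starProjection_conjSpace hfull
  have hQs : star Q = Q := by rw [hQ, star_starProjection]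
  have hZs := star_starProjection (conjSpace N τ)
  have hQp : Q = 1 - (U.map (jacobiFrame N τ : V →ₗ[ℝ] V)).starProjection :=
    hQ.trans (Submodule.starProjection_orthogonal' _)
  have hZp : ∀ v, (conjSpace N τ).starProjection v ∈ U.map (jacobiFrame N τ : V →ₗ[ℝ] V) :=
    fun v => conjSpace_le hfull (Submodule.starProjection_apply_mem _ _)
  have hZZ : (conjSpace N τ).starProjection * (conjSpace N τ).starProjection =
    (conjSpace N τ).starProjection := starProjection_mul_eq_self le_rfl
  rw [← hT] at hZT hTZ hW hB'τ
  set Z := (conjSpace N τ).starProjection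
  set Φ := jacobiFrame N τ
  set P := U.map (Φ : V →ₗ[ℝ] V)
  set p := P.starProjection
  have hp : 1 - Q = p := by rw [hQp, sub_sub_cancel]
  have hpp : p * p = p := starProjection_mul_eq_self le_rfl
  have hps : star p = p := star_starProjection _
  have hQpz : Q * p = 0 := by rw [hQp, sub_mul, one_mul, hpp, sub_self]
  have hZc : Q * (1 - Z) = Q := by rw [mul_sub, mul_one, hQZ, sub_zero]
  have hZc' : (1 - Z) * Q = Q := by rw [sub_mul, one_mul, hZQ, sub_zero]
  have hpZ : p * Z = Z := by rw [← hp, sub_mul, one_mul, hQZ, sub_zero]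
  have hQB' : Q * B' τ = Q * T := by
    rw [hB'τ, mul_sub, mul_one, hTZ, mul_sub, hQZ, sub_zero]
  have hS : star (Q * T * Q) = Q * T * Q := by
    calc star (Q * T * Q) = Q * (star T * Q) := by simp only [star_mul, hQs]
      _ = Q * ((star T * (1 - Z)) * Q) := by rw [mul_assoc (star T), hZc']
      _ = Q * (1 - Z) * T * Q := by rw [hW]; simp only [mul_assoc]
      _ = Q * T * Q := by rw [hZc]
  have hA : star (Q * T * p) = p * (T * Q) := by
    calc star (Q * T * p) = p * (star T * Q) := by simp only [star_mul, hQs, hps]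
      _ = p * ((star T * (1 - Z)) * Q) := by rw [mul_assoc (star T), hZc']
      _ = p * (T * Q) - p * (Z * T * Q) := by rw [hW]; simp only [sub_mul, mul_sub, one_mul]
      _ = p * (T * Q) := by rw [hZT, hZQ, mul_zero, sub_zero]
  have hB'Q : B' τ * Q = T * Q := by rw [hB'τ, mul_assoc, hZc']
  -- off the time `τ` the fields are evaluated by the invertible operator `N t`
  have hev : ∀ᶠ t in 𝓝 τ, t = τ ∨ (t ≠ τ ∧ IsUnit (B t) ∧ IsUnit (N t) ∧
      transverseSp N U t = (U.map (N t : V →ₗ[ℝ] V))ᗮ) := by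
    filter_upwards [eventually_isUnit_of_eq_one (hB τ) hB1] with t ht
    rcases eq_or_ne t τ with h | h
    · exact .inl h
    have hs : t - τ ≠ 0 := sub_ne_zero.2 h
    have hD : IsUnit ((1 - Z) + (t - τ) • Z) := by
      refine isUnit_of_injective fun x hx => ?_
      have h1 : x - Z x + (t - τ) • Z x = 0 := hx
      have h2 : Z (Z x) = Z x := DFunLike.congr_fun hZZ x
      have h3 := congrArg Z h1
      simp only [map_add, map_sub, map_smul, h2, sub_self, zero_add, map_zero,
        smul_eq_zero, hs, false_or] at h3
      simpa [h3] using h1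
    have hNu : IsUnit (N t) := by
      rw [hNB t]
      exact (ht.mul hD).mul (hN.isUnit_jacobiFrame τ)
    exact .inr ⟨h, ht, hNu, by rw [transverseSp, jacobiFrame_eq_of_isUnit hNu]⟩
  have hQt : ∀ᶠ t in 𝓝 τ, (transverseSp N U t).starProjection * (B t * p) = 0 := by
    filter_upwards [hev] with t ht
    rcases ht with rfl | ⟨hne, -, -, hsp⟩
    · rw [← hQ, hB1, one_mul, hQpz]
    ext v
    refine (Submodule.starProjection_apply_eq_zero_iff _).2 ?_
    rw [hsp]
    refine Submodule.le_orthogonal_orthogonal _ ?_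
    have hpv : p v ∈ P := Submodule.starProjection_apply_mem _ _
    have hmem : (p v - Z (p v)) + (t - τ)⁻¹ • Z (p v) ∈ P :=
      P.add_mem (P.sub_mem hpv (hZp _)) (P.smul_mem _ (hZp _))
    obtain ⟨u, hu, hΦu⟩ := hmem
    refine ⟨u, hu, ?_⟩
    have hΦu' : Φ u = (p v - Z (p v)) + (t - τ)⁻¹ • Z (p v) := hΦu
    change N t u = B t (p v)
    rw [hNB t]
    change B t (Φ u - Z (Φ u) + (t - τ) • Z (Φ u)) = _
    have h2 : Z (Z (p v)) = Z (p v) := DFunLike.congr_fun hZZ _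
    congr 1
    rw [hΦu']
    simp only [map_add, map_sub, map_smul, h2, sub_self, zero_add, smul_smul,
      mul_inv_cancel₀ (sub_ne_zero.2 hne), one_smul]
    abel
  have hQC : ∀ᶠ t in 𝓝 τ, (transverseSp N U t).starProjection *
      (star (Ring.inverse (B t)) * (1 - p)) = star (Ring.inverse (B t)) * (1 - p) := by
    filter_upwards [hev] with t ht
    rcases ht with rfl | ⟨hne, hBu, -, hsp⟩
    · rw [← hQ, hB1, Ring.inverse_one, star_one, one_mul, mul_sub, hQpz, mul_one, sub_zero, hQp]
    ext v
    refine Submodule.starProjection_eq_self_iff.2 ?_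
    rw [hsp]
    rintro _ ⟨u, hu, rfl⟩
    change ⟪N t u, star (Ring.inverse (B t)) ((1 - p) v)⟫ = 0
    rw [ContinuousLinearMap.star_eq_adjoint, ContinuousLinearMap.adjoint_inner_right]
    have h1 : Ring.inverse (B t) (N t u) = Φ u - Z (Φ u) + (t - τ) • Z (Φ u) := by
      rw [hNB t, mul_assoc]
      exact DFunLike.congr_fun (Ring.inverse_mul_cancel_left _
        ((1 - Z + (t - τ) • Z) * Φ) hBu) u
    have h2 : Φ u ∈ P := ⟨u, hu, rfl⟩
    have h3 : (1 - p) v ∈ Pᗮ := P.sub_starProjection_mem_orthogonal v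
    rw [h1]
    exact h3 _ (P.add_mem (P.sub_mem h2 (hZp _)) (P.smul_mem _ (hZp _)))
  have hs : ∀ᶠ t in 𝓝 τ, transverseTrace N U t =
      clmTrace ((transverseSp N U t).starProjection * (B' t * Ring.inverse (B t))) := by
    filter_upwards [hev, hQt] with t ht htQ
    rcases ht with rfl | ⟨hne, hBu, hNu, hsp⟩
    · rw [transverseTrace, ← hQ, ← hT, hB1, Ring.inverse_one, mul_one, hQB']
    rw [transverseTrace]
    congr 1
    refine hNu.mul_left_injective ?_
    simp only
    have hN' : deriv N t = (B' t * (1 - Z + (t - τ) • Z) + B t * Z) * Φ := by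
      have hD : HasDerivAt (fun t : ℝ => 1 - Z + (t - τ) • Z) Z t := by
        simpa using (((hasDerivAt_id t).sub_const τ).smul_const Z).const_add (1 - Z)
      have := (((hB t).mul hD).mul_const Φ)
      exact (hN.hasDerivAt t).unique (this.congr_of_eventuallyEq (.of_forall hNB))
    have hBZ : (transverseSp N U t).starProjection * (B t * Z) = 0 := by
      rw [← hpZ, ← mul_assoc (B t), ← mul_assoc, htQ, zero_mul]
    rw [jacobiShape, jacobiFrame_eq_of_isUnit hNu, mul_assoc, mul_assoc (deriv N t),
      Ring.inverse_mul_cancel _ hNu, mul_one, hN', mul_assoc _ _ (N t), mul_assoc (B' t), hNB t,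
      mul_assoc (B t), Ring.inverse_mul_cancel_left _ _ hBu, add_mul, mul_add, ← mul_assoc _ (B t * Z),
      hBZ, zero_mul, add_zero, mul_assoc (B' t)]
  have hmain := hasDerivAt_trace_riccati (s := transverseTrace N U) (r := R τ) hB hB' hB1 hpp
    (hQ.symm.trans hQp) hQt hQC hs
  have hproj := hasDerivAt_projection (hB τ) hB1 hQt hQC
  rw [← hQp, hQB'] at hmain
  rw [← hQp, hQB'] at hproj
  rw [hp]
  refine ⟨hS, hmain hS (by rw [hA, mul_assoc, hB'Q]) hps ?_, ?_⟩
  · rw [mul_add, add_mul, mul_assoc Q (G * Z), mul_assoc G, hZQ, mul_zero, mul_zero, add_zero,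
      mul_neg, neg_mul, mul_assoc, mul_assoc (R τ), hZc', mul_assoc]
  · convert hproj using 2
    rw [← hQB']
    simp only [star_mul, hps, hQs, mul_assoc]

end IsJacobiTensor

end TransverseRiccati

section Comparison

open Filter Topology Set

theorem nonpos_of_deriv_le_mul {f f' : ℝ → ℝ} {a b M : ℝ}
    (hf : ∀ t ∈ Icc a b, HasDerivAt f (f' t) t) (ha : f a ≤ 0)
    (h : ∀ t ∈ Icc a b, 0 < f t → f' t ≤ M * f t) : ∀ t ∈ Icc a b, f t ≤ 0 := by
  intro t ht
  have key : ∀ ε : ℝ, 0 < ε → f t ≤ ε * Real.exp ((M + 1) * t) := by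
    intro ε hε
    have hB : ∀ x, HasDerivAt (fun x => ε * Real.exp ((M + 1) * x))
        (ε * (Real.exp ((M + 1) * x) * (M + 1))) x := fun x => by
      simpa using (((hasDerivAt_id x).const_mul (M + 1)).exp).const_mul ε
    refine image_le_of_deriv_right_lt_deriv_boundary (f := f) (f' := f')
      (fun x hx => (hf x hx).continuousAt.continuousWithinAt)
      (fun x hx => (hf x (Ico_subset_Icc_self hx)).hasDerivWithinAt) (ha.trans (by positivity)) hB
      (fun x hx hfx => ?_) ht
    have hpos : 0 < ε * Real.exp ((M + 1) * x) := by positivity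
    have := h x (Ico_subset_Icc_self hx) (hfx ▸ hpos)
    rw [hfx] at this
    linarith
  refine le_of_forall_pos_le_add fun δ hδ => ?_
  have hE := Real.exp_pos ((M + 1) * t)
  have := key (δ / Real.exp ((M + 1) * t)) (by positivity)
  rwa [div_mul_cancel₀ _ hE.ne', ← zero_add δ] at this

theorem mul_exp_le_of_neg_mul_le_deriv {f f' : ℝ → ℝ} {a b M : ℝ} (hab : a ≤ b)
    (hf : ∀ t ∈ Icc a b, HasDerivAt f (f' t) t)
    (h : ∀ t ∈ Icc a b, -(M * f t) ≤ f' t) :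
    f a * Real.exp (M * a) ≤ f b * Real.exp (M * b) := by
  have hd : ∀ t ∈ Icc a b, HasDerivAt (fun t => f t * Real.exp (M * t))
      (f' t * Real.exp (M * t) + f t * (Real.exp (M * t) * M)) t := fun t ht => by
    have hE : HasDerivAt (fun t => Real.exp (M * t)) (Real.exp (M * t) * M) t := by
      simpa using ((hasDerivAt_id t).const_mul M).exp
    exact (hf t ht).mul hE
  refine monotoneOn_of_deriv_nonneg (f := fun t => f t * Real.exp (M * t)) (convex_Icc a b)
    (fun t ht => (hd t ht).continuousAt.continuousWithinAt)
    (fun t ht => (hd t (interior_subset ht)).differentiableAt.differentiableWithinAt)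
    (fun t ht => ?_) (left_mem_Icc.2 hab) (right_mem_Icc.2 hab) hab
  rw [(hd t (interior_subset ht)).deriv]
  have := h t (interior_subset ht)
  have hE := Real.exp_pos (M * t)
  nlinarith

/-- If a solution of the scalar Riccati equation blows down to `-∞` at `b`, then every subsolution
that starts below it and is defined up to `b` coincides with it. -/
theorem eq_of_riccati_of_tendsto_atBot {κ a b : ℝ} {lam σ σ' : ℝ → ℝ}
    (hlam : ∀ t ∈ Ico a b, HasDerivAt lam (-(lam t ^ 2) - κ) t)
    (hbot : Tendsto lam (𝓝[<] b) atBot)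
    (hσ : ∀ t ∈ Ico a b, HasDerivAt σ (σ' t) t)
    (hle : ∀ t ∈ Ico a b, σ' t ≤ -(σ t ^ 2) - κ) (h0 : σ a ≤ lam a) :
    ∀ t ∈ Ico a b, σ t = lam t := by
  have hsub : ∀ {s : ℝ}, s < b → ∀ t ∈ Icc a s, t ∈ Ico a b := fun hs t ht =>
    ⟨ht.1, ht.2.trans_lt hs⟩
  have hbd : ∀ s < b, ∃ M, ∀ t ∈ Icc a s, |lam t + σ t| ≤ M := fun s hs =>
    isCompact_Icc.exists_bound_of_continuousOn (f := fun t => lam t + σ t) fun t ht =>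
      ((hlam t (hsub hs t ht)).continuousAt.add
        (hσ t (hsub hs t ht)).continuousAt).continuousWithinAt
  have hσle : ∀ t ∈ Ico a b, σ t ≤ lam t := by
    intro s hs
    obtain ⟨M, hM⟩ := hbd s hs.2
    refine sub_nonpos.1 (nonpos_of_deriv_le_mul (M := M) (f := fun t => σ t - lam t)
      (fun t ht => (hσ t (hsub hs.2 t ht)).sub (hlam t (hsub hs.2 t ht)))
      (sub_nonpos.2 h0) (fun t ht hpos => ?_) s ⟨hs.1, le_rfl⟩)
    have h1 := hle t (hsub hs.2 t ht)
    have h2 := neg_le_of_abs_le (hM t ht)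
    nlinarith [mul_nonneg hpos.le (sub_nonneg.2 h2)]
  intro t₁ ht₁
  by_contra hne
  have hlt : σ t₁ < lam t₁ := lt_of_le_of_ne (hσle t₁ ht₁) hne
  have hstrict : ∀ t ∈ Ico t₁ b, σ t < lam t := by
    intro s hs
    obtain ⟨M, hM⟩ := hbd s hs.2
    have h := mul_exp_le_of_neg_mul_le_deriv (M := M) (f := fun t => lam t - σ t) hs.1
      (fun t ht => (hlam t (hsub hs.2 t ⟨ht₁.1.trans ht.1, ht.2⟩)).sub
        (hσ t (hsub hs.2 t ⟨ht₁.1.trans ht.1, ht.2⟩)))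
      (fun t ht => ?_)
    · have h1 : 0 < (lam t₁ - σ t₁) * Real.exp (M * t₁) :=
        mul_pos (sub_pos.2 hlt) (Real.exp_pos _)
      exact sub_pos.1 (pos_of_mul_pos_left (h1.trans_le h) (Real.exp_pos _).le)
    · have ht' : t ∈ Icc a s := ⟨ht₁.1.trans ht.1, ht.2⟩
      have h1 := hle t (hsub hs.2 t ht')
      have h2 := le_of_abs_le (hM t ht')
      have h3 := sub_nonneg.2 (hσle t (hsub hs.2 t ht'))
      nlinarith [mul_nonneg h3 (sub_nonneg.2 h2)]
  have hnear : ∀ᶠ t in 𝓝[<] b, lam t < -1 := hbot.eventually_lt_atBot (-1)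
  obtain ⟨c, hc, hcb⟩ := (mem_nhdsLT_iff_exists_Ioo_subset' ht₁.2).1 hnear
  set t₂ := (max c t₁ + b) / 2 with ht₂
  have hmax : max c t₁ < b := max_lt hc ht₁.2
  have h₂b : t₂ < b := by rw [ht₂]; linarith
  have h₂m : max c t₁ < t₂ := by rw [ht₂]; linarith
  have hl : ∀ t ∈ Ico t₂ b, lam t < -1 := fun t ht =>
    hcb ⟨(le_max_left _ _).trans_lt (h₂m.trans_le ht.1), ht.2⟩
  have hs : ∀ t ∈ Ico t₂ b, σ t < lam t := fun t ht =>
    hstrict t ⟨(le_max_right _ _).trans (h₂m.le.trans ht.1), ht.2⟩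
  have hI : ∀ t ∈ Ico t₂ b, t ∈ Ico a b := fun t ht =>
    ⟨ht₁.1.trans ((le_max_right _ _).trans (h₂m.le.trans ht.1)), ht.2⟩
  have hmono : ∀ s ∈ Ico t₂ b, ((σ t₂)⁻¹ - (lam t₂)⁻¹) * Real.exp (2 * |κ| * t₂) ≤
      ((σ s)⁻¹ - (lam s)⁻¹) * Real.exp (2 * |κ| * s) := by
    intro s hs'
    have hss : ∀ t ∈ Icc t₂ s, t ∈ Ico t₂ b := fun t ht => ⟨ht.1, ht.2.trans_lt hs'.2⟩
    refine mul_exp_le_of_neg_mul_le_deriv (f := fun t => (σ t)⁻¹ - (lam t)⁻¹) hs'.1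
      (fun t ht => ((hσ t (hI t (hss t ht))).inv
        (by linarith [hl t (hss t ht), hs t (hss t ht)])).sub
        ((hlam t (hI t (hss t ht))).inv (by linarith [hl t (hss t ht)]))) (fun t ht => ?_)
    have h1 := hl t (hss t ht)
    have h2 := hs t (hss t ht)
    have h3 := hle t (hI t (hss t ht))
    have hσ0 : σ t ≠ 0 := by linarith
    have hl0 : lam t ≠ 0 := by linarith
    have h4 : 1 + κ * (σ t)⁻¹ ^ 2 ≤ -σ' t / σ t ^ 2 := by
      rw [le_div_iff₀ (by positivity), add_mul, mul_assoc, ← mul_pow, inv_mul_cancel₀ hσ0]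
      linarith
    have h5 : -(-(lam t ^ 2) - κ) / lam t ^ 2 = 1 + κ * (lam t)⁻¹ ^ 2 := by field_simp; ring
    rw [h5]
    have hp : (lam t)⁻¹ < (σ t)⁻¹ := (inv_lt_inv_of_neg (by linarith) (by linarith)).2 h2
    have hp1 : -1 ≤ (lam t)⁻¹ := by
      rw [le_inv_of_neg (by norm_num) (by linarith)]
      norm_num; exact h1.le
    have hq : (σ t)⁻¹ < 0 := inv_lt_zero.2 (by linarith)
    set p := (lam t)⁻¹
    set q := (σ t)⁻¹
    have h6 : -(2 * |κ|) ≤ κ * (p + q) := by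
      have h7 : |κ * (p + q)| ≤ 2 * |κ| := by
        rw [abs_mul, mul_comm]
        refine mul_le_mul_of_nonneg_right ?_ (abs_nonneg _)
        rw [abs_le]; constructor <;> linarith
      exact neg_le_of_abs_le h7
    nlinarith [mul_nonneg (sub_nonneg.2 hp.le) (sub_nonneg.2 h6)]
  have h₂ : t₂ ∈ Ico t₂ b := ⟨le_rfl, h₂b⟩
  have hpos : 0 < ((σ t₂)⁻¹ - (lam t₂)⁻¹) * Real.exp (2 * |κ| * t₂) :=
    mul_pos (sub_pos.2 ((inv_lt_inv_of_neg (by linarith [hl _ h₂]) (by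
      linarith [hl _ h₂, hs _ h₂])).2 (hs _ h₂))) (Real.exp_pos _)
  have hlim : Tendsto (fun s => -(lam s)⁻¹ * Real.exp (2 * |κ| * s)) (𝓝[<] b)
      (𝓝 (-0 * Real.exp (2 * |κ| * b))) :=
    (tendsto_inv_atBot_zero.comp hbot).neg.mul
      ((Real.continuous_exp.comp (continuous_const_mul _)).tendsto b |>.mono_left
        nhdsWithin_le_nhds)
  rw [neg_zero, zero_mul] at hlim
  refine absurd (ge_of_tendsto hlim ?_) (not_le.2 hpos)
  filter_upwards [Ioo_mem_nhdsLT h₂b] with s hs'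
  have hs'' : s ∈ Ico t₂ b := ⟨hs'.1.le, hs'.2⟩
  refine (hmono s hs'').trans (mul_le_mul_of_nonneg_right ?_ (Real.exp_pos _).le)
  have hq : (σ s)⁻¹ < 0 := inv_lt_zero.2 (by linarith [hl _ hs'', hs _ hs''])
  linarith

end Comparison

section Uniqueness

open Set

variable {F : Type*} [NormedAddCommGroup F] [NormedSpace ℝ F]

theorem eq_zero_of_hasDerivAt_smul {f : ℝ → F} {c : ℝ → ℝ} {a b : ℝ}
    (hf : ∀ t ∈ Ico a b, HasDerivAt f (c t • f t) t) (hc : ContinuousOn c (Ico a b))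
    (ha : f a = 0) : ∀ t ∈ Ico a b, f t = 0 := by
  intro s hs
  have hsub : ∀ t ∈ Icc a s, t ∈ Ico a b := fun t ht => ⟨ht.1, ht.2.trans_lt hs.2⟩
  obtain ⟨M, hM⟩ := isCompact_Icc.exists_bound_of_continuousOn (hc.mono hsub)
  refine eq_zero_of_abs_deriv_le_mul_abs_self_of_eq_zero_right (K := M)
    (fun t ht => (hf t (hsub t ht)).continuousAt.continuousWithinAt)
    (fun t ht => (hf t (hsub t (Ico_subset_Icc_self ht))).hasDerivWithinAt) ha
    (fun t ht => ?_) s ⟨hs.1, le_rfl⟩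
  rw [norm_smul]
  exact mul_le_mul_of_nonneg_right (hM t (Ico_subset_Icc_self ht)) (norm_nonneg _)

theorem eq_zero_of_jacobi {R : ℝ → F →L[ℝ] F} {u u' : ℝ → F} {a b : ℝ} (hR : Continuous R)
    (hu : ∀ t, HasDerivAt u (u' t) t) (hu'c : Continuous u')
    (hu' : ∀ t ∈ Ico a b, HasDerivAt u' (-(R t (u t))) t)
    (h0 : u a = 0) (h0' : u' a = 0) : ∀ t ∈ Icc a b, u t = 0 ∧ u' t = 0 := by
  have huc : Continuous u := continuous_iff_continuousAt.2 fun t => (hu t).continuousAt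
  obtain ⟨M, hM⟩ := (isCompact_Icc (a := a) (b := b)).exists_bound_of_continuousOn hR.continuousOn
  have key := eq_zero_of_abs_deriv_le_mul_abs_self_of_eq_zero_right (K := max 1 M)
    (f := fun t => (u t, u' t)) (huc.prodMk hu'c).continuousOn
    (fun t ht => ((hu t).prodMk (hu' t ht)).hasDerivWithinAt) (by simp [h0, h0'])
    (fun t ht => ?_)
  · intro t ht
    simpa using key t ht
  · simp only [Prod.norm_mk, norm_neg]
    refine max_le ?_ ?_
    · calc ‖u' t‖ = 1 * ‖u' t‖ := (one_mul _).symm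
        _ ≤ _ := mul_le_mul (le_max_left _ _) (le_max_right _ _) (norm_nonneg _) (by positivity)
    · exact ((R t).le_opNorm _).trans (mul_le_mul
        ((hM t (Ico_subset_Icc_self ht)).trans (le_max_right _ _)) (le_max_left _ _)
        (norm_nonneg _) (by positivity))

end Uniqueness

section Rigidity

set_option linter.unusedSectionVars false

open Filter Topology Set

theorem eq_of_eqOn_Ico {F : Type*} [NormedAddCommGroup F] [NormedSpace ℝ F] {f g : ℝ → F}
    {f' g' : F} {t b : ℝ} (htb : t < b) (hf : HasDerivAt f f' t) (hg : HasDerivAt g g' t)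
    (h : ∀ s ∈ Ico t b, f s = g s) : f' = g' :=
  (uniqueDiffOn_Ico t b t ⟨le_rfl, htb⟩).eq_deriv _ hf.hasDerivWithinAt
    (hg.hasDerivWithinAt.congr h (h t ⟨le_rfl, htb⟩))

theorem exists_orthonormal_span_eq [FiniteDimensional ℝ V] {k : ℕ} {H : Submodule ℝ V}
    (hk : Module.finrank ℝ H = k) :
    ∃ e : Fin k → V, Orthonormal ℝ e ∧ Submodule.span ℝ (range e) = H := by
  let b := (stdOrthonormalBasis ℝ H).reindex (finCongr hk)
  refine ⟨H.subtypeₗᵢ ∘ b, b.orthonormal.comp_linearIsometry _, ?_⟩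
  have h := b.toBasis.span_eq
  rw [OrthonormalBasis.coe_toBasis] at h
  rw [range_comp]
  change Submodule.span ℝ (H.subtype '' range b) = H
  rw [← Submodule.map_span, h, Submodule.map_top, Submodule.range_subtype]

variable [FiniteDimensional ℝ V] [CompleteSpace V] {R N : ℝ → V →L[ℝ] V} {U : Submodule ℝ V}

theorem clmTrace_starProjection {k : ℕ} {H : Submodule ℝ V} (hk : Module.finrank ℝ H = k) :
    clmTrace H.starProjection = k := by
  obtain ⟨e, he, hH⟩ := exists_orthonormal_span_eq hk
  rw [← mul_one H.starProjection, clmTrace_starProjection_mul he hH]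
  simp [he.1]

namespace IsJacobiTensor

theorem finrank_transverseSp_eq (hN : IsJacobiTensor R N) (U : Submodule ℝ V) (s t : ℝ) :
    Module.finrank ℝ (transverseSp N U s) = Module.finrank ℝ (transverseSp N U t) := by
  have h : ∀ t, Module.finrank ℝ U + Module.finrank ℝ (transverseSp N U t) =
      Module.finrank ℝ V := fun t => by
    rw [← Submodule.finrank_add_finrank_orthogonal (U.map (jacobiFrame N t : V →ₗ[ℝ] V))]
    congr 1
    exact (Submodule.equivMapOfInjective _
      (ContinuousLinearMap.isUnit_iff_bijective.1 (hN.isUnit_jacobiFrame t)).1 U).finrank_eq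
  have h1 := h s
  have h2 := h t
  omega

/-- If the transverse trace starts below `k` times a solution of the scalar Riccati equation that
blows down to `-∞`, then the transverse projection is constant and the transverse shape operator
is a multiple of it. -/
theorem transverse_rigidity (hN : IsJacobiTensor R N) {k : ℕ} (hk0 : k ≠ 0) {κ a b : ℝ}
    (hRic : ∀ t, ∀ e : Fin k → V, Orthonormal ℝ e → (k : ℝ) * κ ≤ ∑ i, ⟪R t (e i), e i⟫)
    {lam : ℝ → ℝ} (hlam : ∀ t ∈ Ico a b, HasDerivAt lam (-(lam t ^ 2) - κ) t)
    (hbot : Tendsto lam (𝓝[<] b) atBot)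
    (hfull : ∀ t ∈ Ico a b, ∀ x, N t x = 0 → x ∈ U)
    (hk : Module.finrank ℝ (transverseSp N U a) = k)
    (hinit : transverseTrace N U a ≤ k * lam a) {t : ℝ} (ht : t ∈ Ico a b) :
    (transverseSp N U t).starProjection = (transverseSp N U a).starProjection ∧
    (transverseSp N U t).starProjection * jacobiShape N t =
      lam t • (transverseSp N U t).starProjection := by
  have hkpos : (0 : ℝ) < k := by exact_mod_cast Nat.pos_of_ne_zero hk0
  set σ : ℝ → ℝ := fun t => transverseTrace N U t / k with hσ
  have hderiv : ∀ τ ∈ Ico a b, ∃ s' : ℝ, HasDerivAt σ s' τ ∧ s' ≤ -(σ τ ^ 2) - κ ∧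
      (s' = -(σ τ ^ 2) - κ →
        HasDerivAt (fun t => (transverseSp N U t).starProjection) 0 τ ∧
        (transverseSp N U τ).starProjection * jacobiShape N τ =
          σ τ • (transverseSp N U τ).starProjection) := by
    intro τ hτ
    have hkτ := (hN.finrank_transverseSp_eq U τ a).trans hk
    obtain ⟨hS, hs, hQd⟩ := hN.hasDerivAt_transverse (hfull τ hτ) rfl rfl
    have hQQ : (transverseSp N U τ).starProjection * (transverseSp N U τ).starProjection =
      (transverseSp N U τ).starProjection := starProjection_mul_eq_self le_rfl
    have hQs := star_starProjection (transverseSp N U τ)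
    have hQk := clmTrace_starProjection hkτ
    have hQR : (k : ℝ) * κ ≤ clmTrace ((transverseSp N U τ).starProjection * R τ) := by
      obtain ⟨e, he, hH⟩ := exists_orthonormal_span_eq hkτ
      rw [clmTrace_starProjection_mul he hH]
      exact hRic τ e he
    have hsτ : clmTrace ((transverseSp N U τ).starProjection * jacobiShape N τ) = k * σ τ := by
      rw [hσ]; simp only; rw [mul_div_cancel₀ _ hkpos.ne']; rfl
    set Q := (transverseSp N U τ).starProjection
    set T := jacobiShape N τ
    set D := Q * T * Q - σ τ • Q with hD
    have htr : clmTrace (Q * T * Q) = k * σ τ := by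
      rw [clmTrace_mul_comm, ← mul_assoc, hQQ, hsτ]
    have hDD : clmTrace (star D * D) =
        clmTrace (star (Q * T * Q) * (Q * T * Q)) - k * σ τ ^ 2 := by
      have h1 : star D * D = star (Q * T * Q) * (Q * T * Q) - (2 * σ τ) • (Q * T * Q) +
          (σ τ ^ 2) • Q := by
        rw [hD, star_sub, hS, star_smul, hQs, star_trivial, sub_mul, mul_sub, mul_sub,
          smul_mul_assoc, smul_mul_assoc, mul_smul_comm, mul_smul_comm, hQQ,
          mul_assoc (Q * T) Q Q, hQQ, mul_assoc Q T Q, ← mul_assoc Q Q, hQQ, smul_smul]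
        module
      rw [h1, map_add, map_sub, map_smul, map_smul, htr, hQk, smul_eq_mul, smul_eq_mul]
      ring
    have hD0 := clmTrace_star_mul_self_nonneg D
    have hA0 := clmTrace_star_mul_self_nonneg (Q * T * (1 - Q))
    refine ⟨_, hs.div_const _, ?_, fun heq => ?_⟩
    · rw [div_le_iff₀ hkpos]
      linarith
    · rw [div_eq_iff hkpos.ne'] at heq
      have hAz := eq_zero_of_clmTrace_star_mul_self_nonpos (A := Q * T * (1 - Q)) (by linarith)
      have hDz := eq_zero_of_clmTrace_star_mul_self_nonpos (A := D) (by linarith)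
      refine ⟨hQd.congr_deriv (by rw [hAz, star_zero, neg_zero, sub_zero]), ?_⟩
      rw [mul_sub, mul_one, sub_eq_zero] at hAz
      rw [hAz]
      exact sub_eq_zero.1 hDz
  choose! σ' hσ' hle hrig using hderiv
  have hab : a < b := ht.1.trans_lt ht.2
  have heq := eq_of_riccati_of_tendsto_atBot hlam hbot hσ' hle
    ((div_le_iff₀' hkpos).2 hinit)
  have hrig' : ∀ τ ∈ Ico a b, HasDerivAt (fun t => (transverseSp N U t).starProjection) 0 τ ∧
        (transverseSp N U τ).starProjection * jacobiShape N τ =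
          σ τ • (transverseSp N U τ).starProjection := fun τ hτ => by
    refine hrig τ hτ ?_
    rw [heq τ hτ]
    exact eq_of_eqOn_Ico hτ.2 (hσ' τ hτ) (hlam τ hτ) fun s hs => heq s ⟨hτ.1.trans hs.1, hs.2⟩
  refine ⟨?_, heq t ht ▸ (hrig' t ht).2⟩
  exact constant_of_has_deriv_right_zero (f := fun t => (transverseSp N U t).starProjection)
    (fun s hs => (hrig' s ⟨hs.1, hs.2.trans_lt ht.2⟩).1.continuousAt.continuousWithinAt)
    (fun s hs => (hrig' s ⟨hs.1, hs.2.trans ht.2⟩).1.hasDerivWithinAt) t ⟨ht.1, le_rfl⟩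

end IsJacobiTensor

end Rigidity

section Splitting

set_option linter.unusedSectionVars false

open Filter Topology Set

variable [FiniteDimensional ℝ V] [CompleteSpace V] {R N : ℝ → V →L[ℝ] V} {U W : Submodule ℝ V}
  {a b t : ℝ}

namespace IsJacobiTensor

theorem hasDerivAt_apply (hN : IsJacobiTensor R N) (x : V) (t : ℝ) :
    HasDerivAt (fun t => N t x) (deriv N t x) t := by
  simpa using (hN.hasDerivAt t).clm_apply (hasDerivAt_const t x)

theorem hasDerivAt_deriv_apply (hN : IsJacobiTensor R N) (x : V) (t : ℝ) :
    HasDerivAt (fun t => deriv N t x) (-(R t (N t x))) t := by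
  simpa using (hN.hasDerivAt_deriv t).clm_apply (hasDerivAt_const t x)

theorem map_jacobiFrame_eq (h : transverseSp N U t = W) :
    U.map (jacobiFrame N t : V →ₗ[ℝ] V) = Wᗮ := by
  rw [← h, transverseSp, Submodule.orthogonal_orthogonal]

theorem apply_mem_orthogonal (hfull : ∀ x, N t x = 0 → x ∈ U)
    (h : transverseSp N U t = W) {u : V} (hu : u ∈ U) : N t u ∈ Wᗮ := by
  rw [← map_jacobiFrame_eq h, ← add_sub_cancel_right (N t u)
    ((conjSpace N t).starProjection (deriv N t u)), ← jacobiFrame_apply]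
  exact Submodule.sub_mem _ ⟨u, hu, rfl⟩
    (conjSpace_le hfull (Submodule.starProjection_apply_mem _ _))

/-- Every vector orthogonal to the transverse space is the sum of the value of a field in `U` and
the derivative of a field in `U` that vanishes. -/
theorem exists_of_mem_orthogonal (hfull : ∀ x, N t x = 0 → x ∈ U)
    (h : transverseSp N U t = W) {y : V} (hy : y ∈ Wᗮ) :
    ∃ u ∈ U, ∃ v ∈ U, N t v = 0 ∧ y = N t u + deriv N t v := by
  rw [← map_jacobiFrame_eq h] at hy
  obtain ⟨u, hu, rfl⟩ := hy
  obtain ⟨v, hv, hvu⟩ := mem_conjSpace.1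
    (Submodule.starProjection_apply_mem (conjSpace N t) (deriv N t u))
  exact ⟨u, hu, v, hfull v hv, hv, by rw [hvu]; rfl⟩

theorem deriv_apply_mem_orthogonal (hN : IsJacobiTensor R N)
    (hfull : ∀ t ∈ Ico a b, ∀ x, N t x = 0 → x ∈ U)
    (h : ∀ t ∈ Ico a b, transverseSp N U t = W) (ht : t ∈ Ico a b) {u : V} (hu : u ∈ U) :
    deriv N t u ∈ Wᗮ := by
  refine (W.starProjection_apply_eq_zero_iff).1 ?_
  refine eq_of_eqOn_Ico ht.2 (W.starProjection.hasFDerivAt.comp_hasDerivAt t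
    (hN.hasDerivAt_apply u t)) (hasDerivAt_const t (0 : V)) fun s hs => ?_
  have hs' : s ∈ Ico a b := ⟨ht.1.trans hs.1, hs.2⟩
  exact (W.starProjection_apply_eq_zero_iff).2 (apply_mem_orthogonal (hfull s hs') (h s hs') hu)

theorem curvature_apply_mem_orthogonal (hN : IsJacobiTensor R N) (hR : Differentiable ℝ R)
    (hfull : ∀ t ∈ Ico a b, ∀ x, N t x = 0 → x ∈ U)
    (h : ∀ t ∈ Ico a b, transverseSp N U t = W) (ht : t ∈ Ico a b) {y : V} (hy : y ∈ Wᗮ) :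
    R t y ∈ Wᗮ := by
  have h1 : ∀ s ∈ Ico a b, ∀ u ∈ U, W.starProjection (R s (N s u)) = 0 := by
    intro s hs u hu
    rw [← neg_eq_zero, ← map_neg]
    refine eq_of_eqOn_Ico hs.2 (W.starProjection.hasFDerivAt.comp_hasDerivAt s
      (hN.hasDerivAt_deriv_apply u s)) (hasDerivAt_const s (0 : V)) fun r hr => ?_
    exact (W.starProjection_apply_eq_zero_iff).2
      (hN.deriv_apply_mem_orthogonal hfull h ⟨hs.1.trans hr.1, hr.2⟩ hu)
  obtain ⟨u, hu, v, hv, hv0, rfl⟩ := exists_of_mem_orthogonal (hfull t ht) (h t ht) hy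
  refine (W.starProjection_apply_eq_zero_iff).1 ?_
  rw [map_add, map_add, h1 t ht u hu, zero_add]
  have h2 := eq_of_eqOn_Ico ht.2 (W.starProjection.hasFDerivAt.comp_hasDerivAt t
      ((hR t).hasDerivAt.clm_apply (hN.hasDerivAt_apply v t))) (hasDerivAt_const t (0 : V))
      fun s hs => h1 s ⟨ht.1.trans hs.1, hs.2⟩ v hv
  rwa [hv0, map_zero, zero_add] at h2

/-- The fields starting in the constant transverse space `W` stay in it and are determined by the
scalar shape operator. -/
theorem apply_mem_and_deriv_apply_eq (hN : IsJacobiTensor R N) (hR : Differentiable ℝ R)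
    (hsymm : ∀ t x y, ⟪R t x, y⟫ = ⟪x, R t y⟫)
    (hfull : ∀ t ∈ Ico a b, ∀ x, N t x = 0 → x ∈ U)
    (h : ∀ t ∈ Ico a b, transverseSp N U t = W) {lam : ℝ → ℝ}
    (hshape : ∀ t ∈ Ico a b, W.starProjection * jacobiShape N t = lam t • W.starProjection)
    {x : V} (hx : jacobiFrame N a x ∈ W) (ht : t ∈ Ico a b) :
    N t x ∈ W ∧ deriv N t x = lam t • N t x := by
  have ha : a ∈ Ico a b := ⟨le_rfl, ht.1.trans_lt ht.2⟩
  have hconj : ∀ t ∈ Ico a b, conjSpace N t ≤ Wᗮ := fun t ht =>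
    (conjSpace_le (hfull t ht)).trans (map_jacobiFrame_eq (h t ht)).le
  have hZx : (conjSpace N a).starProjection (deriv N a x) = 0 := by
    have h1 : (conjSpace N a).starProjection (jacobiFrame N a x) = 0 :=
      (Submodule.starProjection_apply_eq_zero_iff _).2 fun z hz =>
        (real_inner_comm _ _).trans (hconj a ha hz _ hx)
    rw [jacobiFrame_apply, map_add] at h1
    have h2 : (conjSpace N a).starProjection (N a x) = 0 :=
      DFunLike.congr_fun (hN.starProjection_mul a) x
    rwa [h2, zero_add, Submodule.starProjection_eq_self_iff.2
      (Submodule.starProjection_apply_mem _ _)] at h1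
  have hxW : N a x ∈ W := by
    rwa [jacobiFrame_apply, hZx, add_zero] at hx
  have hcomm : ∀ t ∈ Ico a b, ∀ v, Wᗮ.starProjection (R t v) = R t (Wᗮ.starProjection v) := by
    intro t ht v
    have hperp : ∀ y ∈ Wᗮ, R t y ∈ Wᗮ := fun y hy =>
      hN.curvature_apply_mem_orthogonal hR hfull h ht hy
    refine Submodule.eq_starProjection_of_mem_of_inner_eq_zero
      (hperp _ (Submodule.starProjection_apply_mem _ _)) fun y hy => ?_
    rw [← map_sub, hsymm]
    exact Submodule.starProjection_inner_eq_zero v _ (hperp y hy)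
  have hperp : ∀ t ∈ Icc a b,
      Wᗮ.starProjection (N t x) = 0 ∧ Wᗮ.starProjection (deriv N t x) = 0 := by
    refine eq_zero_of_jacobi (R := R) (u := fun t => Wᗮ.starProjection (N t x)) hR.continuous
      (fun t => Wᗮ.starProjection.hasFDerivAt.comp_hasDerivAt t (hN.hasDerivAt_apply x t))
      (continuous_iff_continuousAt.2 fun t => (Wᗮ.starProjection.hasFDerivAt.comp_hasDerivAt t
        (hN.hasDerivAt_deriv_apply x t)).continuousAt)
      (fun t ht => ?_) ?_ ?_
    · rw [← hcomm t ht, ← map_neg]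
      exact Wᗮ.starProjection.hasFDerivAt.comp_hasDerivAt t (hN.hasDerivAt_deriv_apply x t)
    · exact (Submodule.starProjection_apply_eq_zero_iff _).2 (W.le_orthogonal_orthogonal hxW)
    · refine (Submodule.starProjection_apply_eq_zero_iff _).2 fun y hy => ?_
      obtain ⟨u, hu, v, -, hv0, rfl⟩ := exists_of_mem_orthogonal (hfull a ha) (h a ha) hy
      rw [inner_add_left, ← hN.wronskian, real_inner_comm,
        hN.deriv_apply_mem_orthogonal hfull h ha hu _ hxW, zero_add]
      exact (Submodule.starProjection_apply_eq_zero_iff _).1 hZx _ (deriv_mem_conjSpace hv0)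
  have hmem : ∀ v : V, Wᗮ.starProjection v = 0 → v ∈ W := fun v hv => by
    rw [← W.orthogonal_orthogonal]
    exact (Submodule.starProjection_apply_eq_zero_iff _).1 hv
  obtain ⟨h1, h2⟩ := hperp t (Ico_subset_Icc_self ht)
  refine ⟨hmem _ h1, ?_⟩
  have h3 := DFunLike.congr_fun (hshape t ht) (jacobiFrame N t x)
  have h4 : jacobiShape N t (jacobiFrame N t x) = deriv N t x :=
    DFunLike.congr_fun (hN.jacobiShape_mul_jacobiFrame t) x
  have h5 : W.starProjection ((conjSpace N t).starProjection (deriv N t x)) = 0 :=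
    (W.starProjection_apply_eq_zero_iff).2 (hconj t ht (Submodule.starProjection_apply_mem _ _))
  change W.starProjection (jacobiShape N t (jacobiFrame N t x)) =
    lam t • W.starProjection (jacobiFrame N t x) at h3
  rwa [h4, jacobiFrame_apply, map_add, h5, add_zero,
    Submodule.starProjection_eq_self_iff.2 (hmem _ h1),
    Submodule.starProjection_eq_self_iff.2 (hmem _ h2)] at h3

end IsJacobiTensor

end Splitting

section Lagrangian

open Filter Topology Set

theorem IsJacobiField.hasDerivAt {R : ℝ → V →L[ℝ] V} {J : ℝ → V} (hJ : IsJacobiField R J)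
    (t : ℝ) : HasDerivAt J (deriv J t) t :=
  (hJ.1.differentiable (by simp) t).hasDerivAt

theorem IsJacobiField.differentiable_deriv {R : ℝ → V →L[ℝ] V} {J : ℝ → V}
    (hJ : IsJacobiField R J) : Differentiable ℝ (deriv J) :=
  (contDiff_infty_iff_deriv.1 hJ.1).2.differentiable (by simp)

theorem IsJacobiField.hasDerivAt_deriv {R : ℝ → V →L[ℝ] V} {J : ℝ → V} (hJ : IsJacobiField R J)
    (t : ℝ) : HasDerivAt (deriv J) (-(R t (J t))) t :=
  hJ.2 t ▸ (hJ.differentiable_deriv t).hasDerivAt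

theorem IsJacobiField.eq_zero {R : ℝ → V →L[ℝ] V} {J : ℝ → V} (hJ : IsJacobiField R J)
    (hR : Continuous R) {t : ℝ} (h0 : J t = 0) (h0' : deriv J t = 0) : J = 0 := by
  funext s
  rcases le_total t s with hs | hs
  · exact (eq_zero_of_jacobi hR hJ.hasDerivAt hJ.differentiable_deriv.continuous
      (fun r _ => hJ.hasDerivAt_deriv r) h0 h0' s ⟨hs, le_rfl⟩).1
  · have h1 : ∀ r, HasDerivAt (fun r => J (-r)) (-deriv J (-r)) r := fun r => by
      simpa [Function.comp_def] using (hJ.hasDerivAt (-r)).scomp r (hasDerivAt_neg r)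
    have h2 : ∀ r, HasDerivAt (fun r => -deriv J (-r)) (-(R (-r) (J (-r)))) r := fun r => by
      have h := (hJ.hasDerivAt_deriv (-r)).scomp r (hasDerivAt_neg r)
      rw [neg_smul, one_smul] at h
      exact h.neg.congr_deriv (neg_neg _)
    have h3 := eq_zero_of_jacobi (R := fun r => R (-r)) (a := -t) (b := -s)
      (hR.comp continuous_neg) h1
      (hJ.differentiable_deriv.continuous.comp continuous_neg).neg (fun r _ => h2 r)
      (by simpa using h0) (by simpa using h0') (-s) ⟨neg_le_neg hs, le_rfl⟩
    simpa using h3.1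

/-- A Lagrangian subspace of Jacobi fields is parametrised linearly by `V`. -/
theorem IsLagrangian.exists_isJacobiTensor [FiniteDimensional ℝ V] {R : ℝ → V →L[ℝ] V}
    {Λ : Submodule ℝ (ℝ → V)} (hΛ : IsLagrangian R Λ) (hR : Continuous R) :
    ∃ (ι : V →ₗ[ℝ] (ℝ → V)) (N : ℝ → V →L[ℝ] V), Function.Injective ι ∧ LinearMap.range ι = Λ ∧
      IsJacobiTensor R N ∧ (∀ x t, ι x t = N t x) ∧ ∀ x t, deriv (ι x) t = deriv N t x := by
  obtain ⟨hJ, hdim, hw⟩ := hΛ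
  have : Module.Finite ℝ Λ := by
    rcases subsingleton_or_nontrivial V with h | h
    · infer_instance
    · exact Module.finite_of_finrank_pos (hdim ▸ Module.finrank_pos)
  let L : V ≃ₗ[ℝ] Λ := LinearEquiv.ofFinrankEq V Λ hdim.symm
  let ι : V →ₗ[ℝ] (ℝ → V) := Λ.subtype ∘ₗ L.toLinearMap
  have hιΛ : ∀ x, ι x ∈ Λ := fun x => (L x).2
  have hι : Function.Injective ι := Λ.injective_subtype.comp L.injective
  let N : ℝ → V →L[ℝ] V := fun t => LinearMap.toContinuousLinearMap (LinearMap.proj t ∘ₗ ι)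
  have hNι : ∀ x t, ι x t = N t x := fun x t => rfl
  have hN : ContDiff ℝ (⊤ : ℕ∞) N := contDiff_clm_apply_iff.2 fun x => (hJ _ (hιΛ x)).1
  have hN' := contDiff_infty_iff_deriv.1 hN
  have hd : ∀ x t, deriv (ι x) t = deriv N t x := fun x t =>
    ((hN'.1 t).hasDerivAt.clm_apply (hasDerivAt_const t x)).deriv.trans (by simp)
  have hdd : ∀ x t, deriv (deriv (ι x)) t = deriv (deriv N) t x := fun x t => by
    rw [funext (hd x)]
    exact (((hN'.2.differentiable (by simp)) t).hasDerivAt.clm_apply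
      (hasDerivAt_const t x)).deriv.trans (by simp)
  refine ⟨ι, N, hι, ?_, ⟨hN, fun t => ?_, fun t x y => ?_, fun t x h0 h0' => ?_⟩, hNι, hd⟩
  · rw [LinearMap.range_comp, LinearEquiv.range, Submodule.map_top, Submodule.range_subtype]
  · ext x
    rw [← hdd, (hJ _ (hιΛ x)).2]
    rfl
  · rw [← hd, ← hd]
    exact hw _ (hιΛ x) _ (hιΛ y) t
  · exact hι (((hJ _ (hιΛ x)).eq_zero hR h0 ((hd x t).trans h0')).trans (map_zero ι).symm)

end Lagrangian

section Initial

set_option linter.unusedSectionVars false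

variable [FiniteDimensional ℝ V] [CompleteSpace V] {R N : ℝ → V →L[ℝ] V} {U W : Submodule ℝ V}
  {a : ℝ}

namespace IsJacobiTensor

theorem conjSpace_le_orthogonal (hN : IsJacobiTensor R N) (hW : ∀ w ∈ W, ∃ x, N a x = w) :
    conjSpace N a ≤ Wᗮ := by
  intro z hz w hw
  obtain ⟨x, rfl⟩ := hW w hw
  rw [real_inner_comm]
  exact hN.inner_eq_zero hz x

theorem jacobiFrame_mem_orthogonal_iff (hN : IsJacobiTensor R N)
    (hW : ∀ w ∈ W, ∃ x, N a x = w) {x : V} : jacobiFrame N a x ∈ Wᗮ ↔ N a x ∈ Wᗮ :=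
  Submodule.add_mem_iff_left _
    (hN.conjSpace_le_orthogonal hW (Submodule.starProjection_apply_mem _ _))

theorem transverseSp_eq (hN : IsJacobiTensor R N) (hW : ∀ w ∈ W, ∃ x, N a x = w)
    (hU : ∀ u, u ∈ U ↔ N a u ∈ Wᗮ) : transverseSp N U a = W := by
  have h : U = Wᗮ.comap (jacobiFrame N a : V →ₗ[ℝ] V) := by
    ext u
    exact (hU u).trans (hN.jacobiFrame_mem_orthogonal_iff hW).symm
  rw [transverseSp, h, Submodule.map_comap_eq_of_surjective
    (ContinuousLinearMap.isUnit_iff_bijective.1 (hN.isUnit_jacobiFrame a)).2,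
    Submodule.orthogonal_orthogonal]

theorem transverseTrace_eq (hN : IsJacobiTensor R N) (h : transverseSp N U a = W) {k : ℕ}
    {e x : Fin k → V} (he : Orthonormal ℝ e) (hspan : Submodule.span ℝ (Set.range e) = W)
    (hx : ∀ i, N a (x i) = e i) :
    transverseTrace N U a = ∑ i, ⟪deriv N a (x i), e i⟫ := by
  rw [transverseTrace, clmTrace_starProjection_mul he (hspan.trans h.symm)]
  refine Finset.sum_congr rfl fun i _ => ?_
  have h1 : jacobiShape N a (jacobiFrame N a (x i)) = deriv N a (x i) :=
    DFunLike.congr_fun (hN.jacobiShape_mul_jacobiFrame a) (x i)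
  have h2 := DFunLike.congr_fun (hN.jacobiShape_mul_starProjection a) (deriv N a (x i))
  change jacobiShape N a ((conjSpace N a).starProjection (deriv N a (x i))) =
    (conjSpace N a).starProjection (deriv N a (x i)) at h2
  rw [← h1, jacobiFrame_apply, map_add, h2, inner_add_left, hx i, ← hx i,
    hN.inner_eq_zero (Submodule.starProjection_apply_mem _ _), add_zero]

theorem exists_smul_of_deriv_eq (hN : IsJacobiTensor R N) {κ b : ℝ} {lam : ℝ → ℝ}
    (hlam : ∀ t ∈ Set.Ico a b, HasDerivAt lam (-(lam t ^ 2) - κ) t) {x : V} (hx : N a x ∈ W)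
    (hx0 : N a x ≠ 0) (h : ∀ t ∈ Set.Ico a b, deriv N t x = lam t • N t x) :
    ∃ (E : V) (f : ℝ → ℝ), ‖E‖ = 1 ∧ E ∈ W ∧ f a = ‖N a x‖ ∧
      (∀ t ∈ Set.Ico a b, HasDerivAt f (deriv f t) t) ∧
      (∀ t ∈ Set.Ico a b, HasDerivAt (deriv f) (-(κ * f t)) t) ∧
      ∀ t ∈ Set.Ico a b, N t x = f t • E := by
  set E := ‖N a x‖⁻¹ • N a x with hE
  have hn : ‖N a x‖ ≠ 0 := norm_ne_zero_iff.2 hx0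
  have hE1 : ‖E‖ = 1 := by rw [hE, norm_smul, norm_inv, norm_norm, inv_mul_cancel₀ hn]
  have hEx : N a x = ‖N a x‖ • E := by rw [hE, smul_smul, mul_inv_cancel₀ hn, one_smul]
  have hf : ∀ t, HasDerivAt (fun t => ⟪N t x, E⟫) ⟪deriv N t x, E⟫ t := fun t => by
    simpa using (hN.hasDerivAt_apply x t).inner ℝ (hasDerivAt_const t E)
  have hf' : ∀ t, HasDerivAt (fun t => ⟪deriv N t x, E⟫) ⟪-(R t (N t x)), E⟫ t := fun t => by
    simpa using (hN.hasDerivAt_deriv_apply x t).inner ℝ (hasDerivAt_const t E)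
  have hdf : deriv (fun t => ⟪N t x, E⟫) = fun t => ⟪deriv N t x, E⟫ :=
    funext fun t => (hf t).deriv
  have hfa : ⟪N a x, E⟫ = ‖N a x‖ := by
    rw [hEx, inner_smul_left, real_inner_self_eq_norm_sq, hE1, norm_smul, hE1]
    simp
  have hflam : ∀ t ∈ Set.Ico a b, ⟪deriv N t x, E⟫ = lam t * ⟪N t x, E⟫ := fun t ht => by
    rw [h t ht, real_inner_smul_left]
  refine ⟨E, fun t => ⟪N t x, E⟫, hE1, W.smul_mem _ hx, hfa, fun t _ => hdf ▸ hf t,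
    fun t ht => ?_, fun t ht => ?_⟩
  · rw [hdf]
    refine (hf' t).congr_deriv (eq_of_eqOn_Ico ht.2 (hf' t) (((hlam t ht).mul (hf t)).congr_deriv
      ?_) fun s hs => hflam s ⟨ht.1.trans hs.1, hs.2⟩)
    rw [hflam t ht]
    ring
  · refine sub_eq_zero.1 (eq_zero_of_hasDerivAt_smul (f := fun t => N t x - ⟪N t x, E⟫ • E)
      (c := lam) (fun s hs => ?_) (fun s hs => (hlam s hs).continuousAt.continuousWithinAt)
      ?_ t ht)
    · refine ((hN.hasDerivAt_apply x s).sub ((hf s).smul_const E)).congr_deriv ?_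
      rw [hflam s hs, h s hs, smul_sub, mul_smul]
    · rw [hfa, ← hEx, sub_self]

end IsJacobiTensor

end Initial

/-- **Splitting when the comparison function blows down (Lemma 9).** Under the
radial bound `Ric_k ≥ k·κ`, with `λ̃' + λ̃² + κ = 0` on `[t₀, t_max)` and
`λ̃(t) → −∞` as `t → t_max⁻`, initial trace condition on a `k`-dimensional
`W ⊆ {J(t₀) : J ∈ Λ}`, and `𝒱 = {J ∈ Λ : J(t₀) ⊥ W}` of full index on
`[t₀, t_max)`, the Lagrangian `Λ` splits orthogonally on `[t₀, t_max)` as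
`𝒱 ⊕ ℋ`, and every nonzero `K ∈ ℋ` has the form `K = f·E` there, with `E` a
unit vector in `W` and `f'' + κ·f = 0`, `f(t₀) = |K(t₀)|`. -/
theorem riccati_comparison_splitting_blowdown
    [FiniteDimensional ℝ V]
    (k : ℕ) (κ : ℝ)
    (R : ℝ → V →L[ℝ] V)
    (hR_smooth : ContDiff ℝ (⊤ : ℕ∞) R)
    (hR_sym : ∀ t : ℝ, ∀ x y : V, ⟪R t x, y⟫ = ⟪x, R t y⟫)
    (hRic : ∀ t : ℝ, ∀ e : Fin k → V, Orthonormal ℝ e →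
      (k : ℝ) * κ ≤ ∑ i, ⟪R t (e i), e i⟫)
    (Λ : Submodule ℝ (ℝ → V)) (hΛ : IsLagrangian R Λ)
    (t₀ tmax : ℝ) (ht : t₀ < tmax)
    (lam : ℝ → ℝ)
    (hlam : ∀ t ∈ Set.Ico t₀ tmax, HasDerivAt lam (-(lam t ^ 2) - κ) t)
    (hlam_bot : Filter.Tendsto lam (nhdsWithin tmax (Set.Iio tmax)) Filter.atBot)
    (W : Submodule ℝ V) (hWdim : Module.finrank ℝ W = k)
    (hWsub : ∀ x ∈ W, ∃ J ∈ Λ, J t₀ = x)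
    (e : Fin k → V) (heW : ∀ i, e i ∈ W) (heON : Orthonormal ℝ e)
    (hespan : Submodule.span ℝ (Set.range e) = W)
    (J : Fin k → (ℝ → V)) (hJΛ : ∀ i, J i ∈ Λ) (hJe : ∀ i, J i t₀ = e i)
    (hinit : ∑ i, ⟪deriv (J i) t₀, e i⟫ ≤ (k : ℝ) * lam t₀)
    (𝒱 : Submodule ℝ (ℝ → V))
    (h𝒱 : ∀ X : ℝ → V, X ∈ 𝒱 ↔ (X ∈ Λ ∧ ∀ w ∈ W, ⟪X t₀, w⟫ = 0))
    (hfull : ∀ t ∈ Set.Ico t₀ tmax, ∀ X ∈ Λ, X t = 0 → X ∈ 𝒱) :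
    ∃ ℋ : Submodule ℝ (ℝ → V), ℋ ≤ Λ ∧ 𝒱 ⊔ ℋ = Λ ∧ 𝒱 ⊓ ℋ = ⊥ ∧
      (∀ t ∈ Set.Ico t₀ tmax, ∀ X ∈ 𝒱, ∀ Y ∈ ℋ, ⟪X t, Y t⟫ = 0) ∧
      ∀ Y ∈ ℋ, Y ≠ 0 →
        ∃ (E : V) (f : ℝ → ℝ),
          ‖E‖ = 1 ∧ E ∈ W ∧
          f t₀ = ‖Y t₀‖ ∧
          (∀ t ∈ Set.Ico t₀ tmax, HasDerivAt f (deriv f t) t) ∧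
          (∀ t ∈ Set.Ico t₀ tmax, HasDerivAt (deriv f) (-(κ * f t)) t) ∧
          ∀ t ∈ Set.Ico t₀ tmax, Y t = f t • E := by
  have hcomplete := FiniteDimensional.complete ℝ V
  obtain ⟨ι, N, hι, hιΛ, hN, hιN, hιN'⟩ := hΛ.exists_isJacobiTensor hR_smooth.continuous
  have hmemΛ : ∀ x, ι x ∈ Λ := fun x => hιΛ ▸ LinearMap.mem_range_self ι x
  have hpar : ∀ X ∈ Λ, ∃ x, ι x = X := fun X hX => by rwa [← hιΛ] at hX
  set U := 𝒱.comap ι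
  have h𝒱U : 𝒱 = U.map ι := (Submodule.map_comap_eq_self fun X hX =>
    hιΛ ▸ ((h𝒱 X).1 hX).1).symm
  have hW : ∀ w ∈ W, ∃ x, N t₀ x = w := fun w hw => by
    obtain ⟨X, hX, rfl⟩ := hWsub w hw
    obtain ⟨x, rfl⟩ := hpar X hX
    exact ⟨x, (hιN x t₀).symm⟩
  have hU : ∀ u, u ∈ U ↔ N t₀ u ∈ Wᗮ := fun u => by
    rw [Submodule.mem_orthogonal', Submodule.mem_comap, h𝒱, hιN]
    exact and_iff_right (hmemΛ u)
  have hfullN : ∀ t ∈ Set.Ico t₀ tmax, ∀ x, N t x = 0 → x ∈ U := fun t ht x hx =>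
    hfull t ht (ι x) (hmemΛ x) ((hιN x t).trans hx)
  have h₀ : transverseSp N U t₀ = W := hN.transverseSp_eq hW hU
  choose x hx using fun i => hpar (J i) (hJΛ i)
  have htrace : transverseTrace N U t₀ ≤ k * lam t₀ := by
    rw [hN.transverseTrace_eq h₀ heON hespan (x := x) fun i => by rw [← hιN, hx, hJe]]
    simpa only [← hιN', hx] using hinit
  have key : ∀ t ∈ Set.Ico t₀ tmax, (∀ u ∈ U, N t u ∈ Wᗮ) ∧
      ∀ x, jacobiFrame N t₀ x ∈ W → N t x ∈ W ∧ deriv N t x = lam t • N t x := by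
    rcases eq_or_ne k 0 with hk | hk
    · have hW0 : W = ⊥ := Submodule.finrank_eq_zero.1 (hWdim.trans hk)
      refine fun t ht => ⟨fun u _ => by simp [hW0], fun x hx => ?_⟩
      rw [hW0, Submodule.mem_bot] at hx
      simp [eq_zero_of_isUnit (hN.isUnit_jacobiFrame t₀) hx]
    · have hrig := fun t ht => hN.transverse_rigidity hk hRic hlam hlam_bot hfullN
        (h₀ ▸ hWdim) htrace (t := t) ht
      have hsp : ∀ t ∈ Set.Ico t₀ tmax, transverseSp N U t = W := fun t ht =>
        (Submodule.starProjection_inj.1 (hrig t ht).1).trans h₀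
      refine fun t ht => ⟨fun u hu =>
        IsJacobiTensor.apply_mem_orthogonal (hfullN t ht) (hsp t ht) hu, fun x hx =>
        hN.apply_mem_and_deriv_apply_eq (hR_smooth.differentiable (by simp)) hR_sym hfullN hsp
          (fun s hs => ?_) hx ht⟩
      have := (hrig s hs).2
      simpa only [hsp s hs] using this
  have ht₀ : t₀ ∈ Set.Ico t₀ tmax := ⟨le_rfl, ht⟩
  set H : Submodule ℝ V := W.comap (jacobiFrame N t₀ : V →ₗ[ℝ] V)
  have hUΦ : ∀ u, u ∈ U ↔ jacobiFrame N t₀ u ∈ Wᗮ := fun u =>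
    (hU u).trans (hN.jacobiFrame_mem_orthogonal_iff hW).symm
  have hinf : U ⊓ H = ⊥ := by
    rw [eq_bot_iff]
    rintro u ⟨hu, hu'⟩
    exact eq_zero_of_isUnit (hN.isUnit_jacobiFrame t₀)
      (inner_self_eq_zero.1 ((hUΦ u).1 hu _ hu'))
  have hsup : U ⊔ H = ⊤ := by
    rw [eq_top_iff]
    intro u _
    obtain ⟨y, hy⟩ := (ContinuousLinearMap.isUnit_iff_bijective.1 (hN.isUnit_jacobiFrame t₀)).2
      (W.starProjection (jacobiFrame N t₀ u))
    rw [← sub_add_cancel u y]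
    refine Submodule.add_mem_sup ((hUΦ _).2 ?_) ?_
    · rw [map_sub, hy]
      exact W.sub_starProjection_mem_orthogonal _
    · change jacobiFrame N t₀ y ∈ W
      rw [hy]
      exact Submodule.starProjection_apply_mem _ _
  refine ⟨H.map ι, ?_, ?_, ?_, ?_, ?_⟩
  · rintro _ ⟨y, -, rfl⟩
    exact hmemΛ y
  · rw [h𝒱U, ← Submodule.map_sup, hsup, Submodule.map_top, hιΛ]
  · rw [h𝒱U, ← Submodule.map_inf ι hι, hinf, Submodule.map_bot]
  · rintro t ht X hX _ ⟨y, hy, rfl⟩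
    rw [h𝒱U] at hX
    obtain ⟨u, hu, rfl⟩ := hX
    rw [hιN, hιN, real_inner_comm]
    exact (key t ht).1 u hu _ ((key t ht).2 y hy).1
  · rintro _ ⟨y, hy, rfl⟩ hne
    have hy0 : N t₀ y ≠ 0 := fun h => hne (by
      have hyU : y ∈ U ⊓ H := ⟨hfullN t₀ ht₀ y h, hy⟩
      rw [hinf, Submodule.mem_bot] at hyU
      rw [hyU, map_zero])
    simpa only [hιN] using hN.exists_smul_of_deriv_eq hlam ((key t₀ ht₀).2 y hy).1 hy0
      fun t ht => ((key t ht).2 y hy).2
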